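/- Let θ > 1 be an irrational number of finite type and let ψ ≥ 0. Then, uniformly for (log x)^{3+ε} ≤ y ≤ x (for any fixed ε > 0), the number of integers n with 1 ≤ n ≤ x such that ⌊θn + ψ⌋ is y-smooth equals (1/θ)·Ψ(θx, y)·(1 + o(1)) as x → ∞. Precisely: for every ε > 0 and every δ > 0 there exists x₀ such that for all x ≥ x₀ and all y with (log x)^{3+ε} ≤ y ≤ x, one has |#{n ∈ ℕ : 1 ≤ n ≤ x, P(⌊θn + ψ⌋) ≤ y} − (1/θ)Ψ(θx, y)| ≤ δ·Ψ(θx, y). -/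

import Mathlib

open scoped Classical

noncomputable section

/-- `n` is `y`-smooth: every prime factor of `n` is at most `y`. -/
def IsSmooth (y : ℝ) (n : ℕ) : Prop := ∀ p : ℕ, p.Prime → p ∣ n → (p : ℝ) ≤ y

/-- `Ψ(X, y)`: the number of `y`-smooth integers `n` with `1 ≤ n ≤ X`. -/
def Psi (X y : ℝ) : ℕ := Nat.card {n : ℕ | 1 ≤ n ∧ (n : ℝ) ≤ X ∧ IsSmooth y n}

/-- `e(t) = exp(2πit)`. -/
def e2pi (t : ℝ) : ℂ := Complex.exp (2 * Real.pi * Complex.I * t)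

/-- `alphaEq x y a` says `a` solves `∑_{p ≤ y prime} log p / (p^a - 1) = log x`,
i.e. `a = α(x, y)`. -/
def alphaEq (x y a : ℝ) : Prop :=
  ∑ p ∈ (Finset.range (⌊y⌋₊ + 1)).filter Nat.Prime,
    Real.log p / ((p : ℝ) ^ a - 1) = Real.log x

/-! ### Smooth numbers up to `N` -/

/-- The `y`-smooth integers in `[1, N]`. -/
def smoothUpTo (y : ℝ) (N : ℕ) : Finset ℕ := (Finset.Icc 1 N).filter (IsSmooth y)

lemma mem_smoothUpTo {y : ℝ} {N n : ℕ} :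
    n ∈ smoothUpTo y N ↔ 1 ≤ n ∧ n ≤ N ∧ IsSmooth y n := by
  simp [smoothUpTo, and_assoc]

lemma IsSmooth.of_dvd {y : ℝ} {m n : ℕ} (h : IsSmooth y n) (hmn : m ∣ n) : IsSmooth y m :=
  fun p hp hpm => h p hp (hpm.trans hmn)

lemma IsSmooth.mul {y : ℝ} {m n : ℕ} (hm : IsSmooth y m) (hn : IsSmooth y n) :
    IsSmooth y (m * n) := fun p hp hpmn =>
  ((Nat.Prime.dvd_mul hp).1 hpmn).elim (hm p hp) (hn p hp)

lemma isSmooth_one (y : ℝ) : IsSmooth y 1 := fun _ hp h =>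
  absurd (Nat.dvd_one.1 h) hp.one_lt.ne'

lemma isSmooth_prime {y : ℝ} {p : ℕ} (hp : p.Prime) (h : (p : ℝ) ≤ y) : IsSmooth y p :=
  fun _ hq hqp => ((Nat.prime_dvd_prime_iff_eq hq hp).1 hqp) ▸ h

lemma isSmooth_of_le {y : ℝ} {n : ℕ} (hn : n ≠ 0) (h : (n : ℝ) ≤ y) : IsSmooth y n :=
  fun _ _ hpn => le_trans (by exact_mod_cast Nat.le_of_dvd (Nat.pos_of_ne_zero hn) hpn) h

lemma Psi_eq_card (X y : ℝ) : Psi X y = (smoothUpTo y ⌊X⌋₊).card := by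
  have : {n : ℕ | 1 ≤ n ∧ (n : ℝ) ≤ X ∧ IsSmooth y n} = (smoothUpTo y ⌊X⌋₊ : Set ℕ) := by
    ext n
    simp only [Set.mem_ofPred_eq, Finset.mem_coe, mem_smoothUpTo]
    constructor
    · rintro ⟨h1, h2, h3⟩
      exact ⟨h1, (Nat.le_floor_iff' (by omega)).2 h2, h3⟩
    · rintro ⟨h1, h2, h3⟩
      exact ⟨h1, (Nat.le_floor_iff' (by omega)).1 h2, h3⟩
  rw [Psi, this]
  simp

lemma smoothUpTo_mono {y : ℝ} {M N : ℕ} (h : M ≤ N) : smoothUpTo y M ⊆ smoothUpTo y N :=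
  fun n hn => by rw [mem_smoothUpTo] at hn ⊢; exact ⟨hn.1, hn.2.1.trans h, hn.2.2⟩

/-! ### Exponentials -/

lemma norm_e2pi (t : ℝ) : ‖e2pi t‖ = 1 := by
  have : (2 * Real.pi * Complex.I * t : ℂ) = ((2 * Real.pi * t : ℝ) : ℂ) * Complex.I := by
    push_cast; ring
  rw [e2pi, this, Complex.norm_exp_ofReal_mul_I]

lemma e2pi_add (s t : ℝ) : e2pi (s + t) = e2pi s * e2pi t := by
  rw [e2pi, e2pi, e2pi, ← Complex.exp_add]; push_cast; ring_nf

lemma conj_e2pi (t : ℝ) : (starRingEnd ℂ) (e2pi t) = e2pi (-t) := by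
  rw [e2pi, e2pi, ← Complex.exp_conj]; simp [Complex.conj_ofNat]

lemma e2pi_nat_mul (n : ℕ) (t : ℝ) : e2pi (n * t) = e2pi t ^ n := by
  rw [e2pi, e2pi, ← Complex.exp_nat_mul]; push_cast; ring_nf

lemma e2pi_int (n : ℤ) : e2pi n = 1 := by
  rw [e2pi, Complex.exp_eq_one_iff]; exact ⟨n, by push_cast; ring⟩

lemma four_mul_norm_le_norm_e2pi_sub_one (t : ℝ) :
    4 * ‖(t : UnitAddCircle)‖ ≤ ‖e2pi t - 1‖ := by
  rw [UnitAddCircle.norm_eq]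
  set s := t - round t with hs
  have hs2 : |s| ≤ 1 / 2 := abs_sub_round t
  have h1 : e2pi t = e2pi s := by
    have : t = s + (round t : ℤ) := by simp [hs]
    conv_lhs => rw [this]
    rw [e2pi_add, e2pi_int, mul_one]
  have h2 : e2pi s = Complex.exp (Complex.I * ((2 * Real.pi * s : ℝ) : ℂ)) := by
    rw [e2pi]; push_cast; ring_nf
  rw [h1, h2, Complex.norm_exp_I_mul_ofReal_sub_one, Real.norm_eq_abs, abs_mul, abs_two]
  have h3 : |Real.sin (2 * Real.pi * s / 2)| = Real.sin (Real.pi * |s|) := by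
    rw [show 2 * Real.pi * s / 2 = Real.pi * s by ring, Real.abs_sin_eq_sin_abs_of_abs_le_pi]
    · rw [abs_mul, abs_of_pos Real.pi_pos]
    · rw [abs_mul, abs_of_pos Real.pi_pos]; nlinarith [Real.pi_pos]
  rw [h3]
  have := Real.mul_le_sin (x := Real.pi * |s|) (by positivity) (by nlinarith [Real.pi_pos])
  have h4 : 2 / Real.pi * (Real.pi * |s|) = 2 * |s| := by field_simp
  linarith

lemma norm_sum_e2pi_mul_le (a b : ℕ) (β : ℝ) :
    ‖∑ d ∈ Finset.Ioc a b, e2pi (d * β)‖ * (2 * ‖(β : UnitAddCircle)‖) ≤ 1 := by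
  have key : ‖∑ d ∈ Finset.Ioc a b, e2pi (d * β)‖ * ‖e2pi β - 1‖ ≤ 2 := by
    rw [← norm_mul]
    rcases le_or_gt b a with h | h
    · simp [Finset.Ioc_eq_empty_of_le h]
    · have : (∑ d ∈ Finset.Ioc a b, e2pi (d * β)) * (e2pi β - 1)
          = e2pi β ^ (b + 1) - e2pi β ^ (a + 1) := by
        have h5 : Finset.Ioc a b = Finset.Ico (a + 1) (b + 1) := by ext; simp
        simp_rw [e2pi_nat_mul, h5]
        exact geom_sum_Ico_mul _ (by omega)
      rw [this]
      refine (norm_sub_le _ _).trans ?_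
      norm_num [norm_e2pi]
  have := four_mul_norm_le_norm_e2pi_sub_one β
  nlinarith [norm_nonneg (∑ d ∈ Finset.Ioc a b, e2pi (d * β)), norm_nonneg (β : UnitAddCircle)]

lemma norm_sum_e2pi_mul_le_card (s : Finset ℕ) (f : ℕ → ℝ) :
    ‖∑ d ∈ s, e2pi (f d)‖ ≤ s.card := by
  refine (norm_sum_le _ _).trans ?_
  simp [norm_e2pi]

/-! ### Bilinear sums -/

/-- The truncated kernel `min(Y, 1 / (2‖t‖))` bounds linear exponential sums of length `Y`. -/
def expKernel (Y t : ℝ) : ℝ :=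
  if (t : UnitAddCircle) = 0 then Y else min Y (1 / (2 * ‖(t : UnitAddCircle)‖))

lemma norm_sum_Ioc_le_expKernel {a b : ℕ} {Y : ℝ} (h : ((Finset.Ioc a b).card : ℝ) ≤ Y) (β : ℝ) :
    ‖∑ d ∈ Finset.Ioc a b, e2pi (d * β)‖ ≤ expKernel Y β := by
  have h1 := (norm_sum_e2pi_mul_le_card (Finset.Ioc a b) (fun d => d * β)).trans h
  unfold expKernel
  split_ifs with h0
  · exact h1
  · refine le_min h1 ?_
    rw [le_div_iff₀ (by have := norm_pos_iff.2 h0; positivity)]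
    exact norm_sum_e2pi_mul_le a b β

/-- If few elements `k` of `B` have `α k` close to any given point modulo one, then the kernel is
small on average over `B`. -/
lemma sum_expKernel_le {B : Finset ℕ} {α Y : ℝ} {D : ℕ} (hD : 1 ≤ D) (hY : 0 ≤ Y) {N₀ : ℝ}
    (h : ∀ γ : ℝ, ((B.filter fun k : ℕ => ‖((α * k - γ : ℝ) : UnitAddCircle)‖ ≤ 1 / D).card : ℝ) ≤ N₀)
    (γ : ℝ) :
    ∑ k ∈ B, expKernel Y (α * k - γ) ≤ N₀ * (2 * Y + D * (1 + Real.log D)) := by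
  have hD0 : (0 : ℝ) < D := by exact_mod_cast hD
  have hN₀ : 0 ≤ N₀ := le_trans (Nat.cast_nonneg _) (h 0)
  set w : ℕ → ℝ := fun j => if j = 0 then Y else D / (2 * j) with hw
  have hw0 : ∀ j, 0 ≤ w j := fun j => by simp only [hw]; split_ifs <;> positivity
  set J : ℕ → ℕ := fun k => ⌊D * Int.fract (α * k - γ)⌋₊ with hJ
  have hJD : ∀ k, J k < D := fun k => by
    rw [hJ]
    have h1 := Int.fract_lt_one (α * k - γ)
    rw [Nat.floor_lt (by have := Int.fract_nonneg (α * k - γ); positivity)]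
    nlinarith
  have hker : ∀ k : ℕ, expKernel Y (α * k - γ) ≤ w (J k) + w (D - 1 - J k) := by
    intro k
    set t := α * k - γ with ht
    have hu0 := Int.fract_nonneg t
    have hu1 := Int.fract_lt_one t
    have hY' : expKernel Y t ≤ Y := by
      unfold expKernel; split_ifs
      · exact le_rfl
      · exact min_le_left _ _
    have hj : (J k : ℝ) ≤ D * Int.fract t := Nat.floor_le (by positivity)
    have hj' : D * Int.fract t < J k + 1 := Nat.lt_floor_add_one _
    by_cases h0 : J k = 0
    · have : w (J k) = Y := by simp [hw, h0]
      linarith [hw0 (D - 1 - J k)]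
    by_cases h1 : D - 1 - J k = 0
    · have : w (D - 1 - J k) = Y := by simp [hw, h1]
      linarith [hw0 (J k)]
    have hjpos : (0 : ℝ) < J k := by exact_mod_cast Nat.pos_of_ne_zero h0
    have hjpos' : (0 : ℝ) < ((D - 1 - J k : ℕ) : ℝ) := by exact_mod_cast Nat.pos_of_ne_zero h1
    have hcast : ((D - 1 - J k : ℕ) : ℝ) = D - 1 - J k := by
      rw [Nat.cast_sub (by have := hJD k; omega), Nat.cast_sub hD]; simp
    have hnorm : ‖(t : UnitAddCircle)‖ = min (Int.fract t) (1 - Int.fract t) := by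
      rw [UnitAddCircle.norm_eq, abs_sub_round_eq_min]
    have hw1 : w (J k) = D / (2 * J k) := by simp [hw, h0]
    have hw2 : w (D - 1 - J k) = D / (2 * ((D - 1 - J k : ℕ) : ℝ)) := by simp [hw, h1]
    have hup : 0 < Int.fract t := by
      by_contra hneg
      have : Int.fract t = 0 := le_antisymm (not_lt.1 hneg) hu0
      rw [this] at hj; linarith
    unfold expKernel
    rw [if_neg]
    · refine (min_le_right _ _).trans ?_
      rw [hnorm]
      rcases min_cases (Int.fract t) (1 - Int.fract t) with ⟨he, -⟩ | ⟨he, -⟩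
      · rw [he]
        have : 1 / (2 * Int.fract t) ≤ w (J k) := by
          rw [hw1, div_le_div_iff₀ (by positivity) (by positivity)]; linarith
        linarith [hw0 (D - 1 - J k)]
      · rw [he]
        have : 1 / (2 * (1 - Int.fract t)) ≤ w (D - 1 - J k) := by
          rw [hw2, div_le_div_iff₀ (by linarith) (by positivity)]; rw [hcast]; nlinarith
        linarith [hw0 (J k)]
    · rw [← norm_eq_zero, hnorm]
      exact (lt_min hup (by linarith)).ne'
  have hfib : ∀ j ∈ Finset.range D, ((B.filter fun k => J k = j).card : ℝ) ≤ N₀ := by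
    intro j _
    refine le_trans ?_ (h (γ + j / D))
    refine Nat.cast_le.2 (Finset.card_le_card fun k hk => ?_)
    rw [Finset.mem_filter] at hk ⊢
    refine ⟨hk.1, ?_⟩
    have hj : (J k : ℝ) ≤ D * Int.fract (α * k - γ) :=
      Nat.floor_le (by have := Int.fract_nonneg (α * k - γ); positivity)
    have hj' : D * Int.fract (α * k - γ) < J k + 1 := Nat.lt_floor_add_one _
    rw [hk.2] at hj hj'
    have he : α * k - (γ + j / D) = (Int.fract (α * k - γ) - j / D) + (⌊α * k - γ⌋ : ℤ) := by
      rw [← Int.self_sub_floor]; ring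
    have he2 : ((α * k - (γ + j / D) : ℝ) : UnitAddCircle)
        = ((Int.fract (α * k - γ) - j / D : ℝ) : UnitAddCircle) := by
      rw [he, AddCircle.coe_add]
      have : (((⌊α * k - γ⌋ : ℤ) : ℝ) : UnitAddCircle) = 0 :=
        (AddCircle.coe_eq_zero_iff 1).2 ⟨⌊α * k - γ⌋, by simp⟩
      rw [this, add_zero]
    rw [he2]
    refine (QuotientAddGroup.norm_mk_le_norm).trans ?_
    rw [Real.norm_eq_abs, abs_of_nonneg, sub_le_iff_le_add, ← add_div, le_div_iff₀ hD0]
    · linarith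
    · rw [sub_nonneg, div_le_iff₀ hD0]; linarith
  have hsumw : ∑ j ∈ Finset.range D, (w j + w (D - 1 - j)) ≤ 2 * Y + D * (1 + Real.log D) := by
    rw [Finset.sum_add_distrib, Finset.sum_range_reflect w D, ← two_mul]
    obtain ⟨E, rfl⟩ : ∃ E, D = E + 1 := ⟨D - 1, by omega⟩
    rw [Finset.sum_range_succ']
    have h1 : ∀ j ∈ Finset.range E, w (j + 1) = ((E + 1 : ℕ) : ℝ) / 2 * ((j + 1 : ℕ) : ℝ)⁻¹ := by
      intro j _; simp only [hw]; rw [if_neg (by omega)]; field_simp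
    rw [Finset.sum_congr rfl h1, ← Finset.mul_sum]
    have h2 := harmonic_le_one_add_log E
    rw [harmonic] at h2
    push_cast at h2
    have h3 : Real.log E ≤ Real.log ((E + 1 : ℕ) : ℝ) := by
      rcases Nat.eq_zero_or_pos E with rfl | hE
      · simp
      · exact Real.log_le_log (by exact_mod_cast hE) (by push_cast; linarith)
    have h4 : w 0 = Y := by simp [hw]
    rw [h4]
    push_cast at h3 ⊢
    have : (0 : ℝ) ≤ E := Nat.cast_nonneg _
    nlinarith
  calc ∑ k ∈ B, expKernel Y (α * k - γ)
      ≤ ∑ k ∈ B, (w (J k) + w (D - 1 - J k)) := Finset.sum_le_sum fun k _ => hker k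
    _ = ∑ j ∈ Finset.range D, ∑ k ∈ B.filter (fun k => J k = j), (w (J k) + w (D - 1 - J k)) :=
        (Finset.sum_fiberwise_of_maps_to (fun k _ => Finset.mem_range.2 (hJD k)) _).symm
    _ = ∑ j ∈ Finset.range D, ((B.filter fun k => J k = j).card : ℝ) * (w j + w (D - 1 - j)) := by
        refine Finset.sum_congr rfl fun j _ => ?_
        rw [← nsmul_eq_mul, ← Finset.sum_const]
        refine Finset.sum_congr rfl fun k hk => ?_
        rw [(Finset.mem_filter.1 hk).2]
    _ ≤ ∑ j ∈ Finset.range D, N₀ * (w j + w (D - 1 - j)) :=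
        Finset.sum_le_sum fun j hj =>
          mul_le_mul_of_nonneg_right (hfib j hj) (add_nonneg (hw0 _) (hw0 _))
    _ ≤ _ := by rw [← Finset.mul_sum]; exact mul_le_mul_of_nonneg_left hsumw hN₀

/-- Cauchy–Schwarz bound for bilinear exponential sums with a hyperbolic cut-off. -/
lemma sq_norm_bilinear_le {A B : Finset ℕ} {α Y N₀ : ℝ} {D N T : ℕ} (hD : 1 ≤ D)
    (hA : A ⊆ Finset.Ioc D T) (hT : (T : ℝ) ≤ Y)
    (h : ∀ γ : ℝ, ((B.filter fun k : ℕ => ‖((α * k - γ : ℝ) : UnitAddCircle)‖ ≤ 1 / D).card : ℝ) ≤ N₀) :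
    ‖∑ d ∈ A, ∑ k ∈ B.filter (fun k => d * k ≤ N), e2pi (α * (d * k : ℕ))‖ ^ 2 ≤
      A.card * (B.card * (N₀ * (2 * Y + D * (1 + Real.log D)))) := by
  have hY : 0 ≤ Y := le_trans (Nat.cast_nonneg _) hT
  set g : ℕ → ℂ := fun d => ∑ k ∈ B.filter (fun k => d * k ≤ N), e2pi (α * (d * k : ℕ)) with hg
  have h1 : ‖∑ d ∈ A, g d‖ ^ 2 ≤ A.card * ∑ d ∈ Finset.Ioc D T, ‖g d‖ ^ 2 := by
    calc ‖∑ d ∈ A, g d‖ ^ 2 ≤ (∑ d ∈ A, ‖g d‖) ^ 2 := by gcongr; exact norm_sum_le _ _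
      _ ≤ A.card * ∑ d ∈ A, ‖g d‖ ^ 2 := sq_sum_le_card_mul_sum_sq
      _ ≤ _ := by
        gcongr
  refine h1.trans (mul_le_mul_of_nonneg_left ?_ (Nat.cast_nonneg _))
  have hexp : ∀ d, ((‖g d‖ ^ 2 : ℝ) : ℂ) = ∑ k ∈ B, ∑ l ∈ B,
      if d * k ≤ N ∧ d * l ≤ N then e2pi (d * (α * l - α * k)) else 0 := by
    intro d
    rw [← Complex.normSq_eq_norm_sq, ← Complex.mul_conj, mul_comm, hg]
    simp only [map_sum, Finset.sum_mul_sum, Finset.sum_filter]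
    refine Finset.sum_congr rfl fun k _ => ?_
    split_ifs with hk
    · refine Finset.sum_congr rfl fun l _ => ?_
      by_cases hl : d * l ≤ N
      · rw [if_pos hl, if_pos ⟨hk, hl⟩, conj_e2pi, ← e2pi_add]
        push_cast; ring_nf
      · rw [if_neg hl, if_neg (fun h => hl h.2), mul_zero]
    · simp [hk]
  have h2 : ((∑ d ∈ Finset.Ioc D T, ‖g d‖ ^ 2 : ℝ) : ℂ) = ∑ k ∈ B, ∑ l ∈ B,
      ∑ d ∈ (Finset.Ioc D T).filter (fun d => d * k ≤ N ∧ d * l ≤ N),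
        e2pi (d * (α * l - α * k)) := by
    push_cast
    simp_rw [← Complex.ofReal_pow, hexp, Finset.sum_filter]
    rw [Finset.sum_comm]
    exact Finset.sum_congr rfl fun k _ => Finset.sum_comm
  have h3 : ∑ d ∈ Finset.Ioc D T, ‖g d‖ ^ 2 ≤ ∑ k ∈ B, ∑ l ∈ B, expKernel Y (α * l - α * k) := by
    have h0 : 0 ≤ ∑ d ∈ Finset.Ioc D T, ‖g d‖ ^ 2 := Finset.sum_nonneg fun _ _ => by positivity
    rw [← abs_of_nonneg h0, ← Real.norm_eq_abs, ← Complex.norm_real, h2]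
    refine (norm_sum_le _ _).trans (Finset.sum_le_sum fun k _ => ?_)
    refine (norm_sum_le _ _).trans (Finset.sum_le_sum fun l _ => ?_)
    obtain ⟨T', hT', hset⟩ : ∃ T' ≤ T,
        (Finset.Ioc D T).filter (fun d => d * k ≤ N ∧ d * l ≤ N) = Finset.Ioc D T' := by
      rcases Nat.eq_zero_or_pos (max k l) with hm | hm
      · refine ⟨T, le_rfl, Finset.filter_true_of_mem fun d _ => ?_⟩
        have hk : k = 0 := by omega
        have hl : l = 0 := by omega
        simp [hk, hl]
      · refine ⟨min T (N / max k l), min_le_left _ _, ?_⟩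
        ext d
        simp only [Finset.mem_filter, Finset.mem_Ioc, le_min_iff, Nat.le_div_iff_mul_le hm]
        have : d * max k l = max (d * k) (d * l) := Nat.mul_max_mul_left d k l |>.symm
        rw [this, max_le_iff, and_assoc]
    rw [hset]
    refine norm_sum_Ioc_le_expKernel ?_ _
    rw [Nat.card_Ioc]
    exact le_trans (by exact_mod_cast (Nat.sub_le _ _).trans hT') hT
  refine h3.trans ?_
  calc _ ≤ ∑ k ∈ B, N₀ * (2 * Y + D * (1 + Real.log D)) :=
        Finset.sum_le_sum fun k _ => sum_expKernel_le hD hY h (α * k)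
    _ = _ := by rw [Finset.sum_const, nsmul_eq_mul]

/-! ### Greedy factorisation of smooth numbers -/

/-- `d` is the shortest product of the smallest prime factors (in increasing order, the last one
being `p`) of `d * k` that exceeds `D`. -/
structure IsGreedy (D p d k : ℕ) : Prop where
  prime : p.Prime
  dvd : p ∣ d
  lt : D < d
  div_le : d / p ≤ D
  smooth : IsSmooth p d
  rough : ∀ r : ℕ, r.Prime → r ∣ k → p ≤ r

lemma exists_isGreedy {D : ℕ} (hD : 1 ≤ D) (m : ℕ) (hm : D < m) :
    ∃ p d k, m = d * k ∧ IsGreedy D p d k := by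
  induction m using Nat.strong_induction_on with
  | _ m ih =>
    have hm0 : m ≠ 0 := by omega
    have hne : m.primeFactors.Nonempty := Nat.nonempty_primeFactors.2 (by omega)
    obtain ⟨P, hP, hmax⟩ := m.primeFactors.exists_max_image id hne
    have hPp := Nat.prime_of_mem_primeFactors hP
    have hPd := Nat.dvd_of_mem_primeFactors hP
    have hmax' : ∀ r : ℕ, r.Prime → r ∣ m → r ≤ P := fun r hr hrm =>
      hmax r (Nat.mem_primeFactors.2 ⟨hr, hrm, hm0⟩)
    rcases le_or_gt (m / P) D with h | h
    · refine ⟨P, m, 1, by simp, hPp, hPd, hm, h, fun r hr hrm => by exact_mod_cast hmax' r hr hrm, ?_⟩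
      intro r hr hr1
      exact absurd (Nat.dvd_one.1 hr1) hr.one_lt.ne'
    · obtain ⟨p, d, k, hmk, hg⟩ := ih (m / P) (Nat.div_lt_self (by omega) hPp.one_lt) h
      refine ⟨p, d, k * P, ?_, hg.prime, hg.dvd, hg.lt, hg.div_le, hg.smooth, ?_⟩
      · rw [← mul_assoc, ← hmk, Nat.div_mul_cancel hPd]
      · intro r hr hrk
        rcases (Nat.Prime.dvd_mul hr).1 hrk with h1 | h1
        · exact hg.rough r hr h1
        · rw [(Nat.prime_dvd_prime_iff_eq hr hPp).1 h1]
          refine hmax' p hg.prime ?_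
          exact (hg.dvd.trans ⟨k, hmk⟩).trans (Nat.div_dvd_of_dvd hPd)

lemma IsGreedy.coprime_of_lt {D p d k p' d' k' s : ℕ} (h : IsGreedy D p d k)
    (h' : IsGreedy D p' d' k') (hs : s ∣ d) (hp : p < p' ∨ p = p' ∧ ¬ p ∣ s) :
    s.Coprime k' := by
  refine Nat.Coprime.symm (Nat.Coprime.symm (Nat.coprime_of_dvd ?_))
  intro r hr hrs hrk
  have h1 : r ≤ p := by exact_mod_cast h.smooth r hr (hrs.trans hs)
  have h2 := h'.rough r hr hrk
  rcases hp with hp | ⟨rfl, hp⟩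
  · omega
  · exact hp ((le_antisymm h1 h2) ▸ hrs)

lemma IsGreedy.not_dvd_div {D p d k p' d' k' : ℕ} (h : IsGreedy D p d k)
    (h' : IsGreedy D p' d' k') : ¬ d ∣ d' / p' := fun hd => by
  have hpos : 0 < d' / p' := Nat.div_pos
    (Nat.le_of_dvd (lt_of_le_of_lt (Nat.zero_le _) h'.lt) h'.dvd) h'.prime.pos
  exact absurd (h.lt.trans_le ((Nat.le_of_dvd hpos hd).trans h'.div_le)) (lt_irrefl _)

lemma IsGreedy.prime_le {D p d k p' d' k' : ℕ} (h : IsGreedy D p d k)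
    (h' : IsGreedy D p' d' k') (he : d * k = d' * k') : p' ≤ p := by
  by_contra! hlt
  have h1 : d.Coprime k' := h.coprime_of_lt h' dvd_rfl (Or.inl hlt)
  have h2 : d ∣ d' := h1.dvd_of_dvd_mul_right (he ▸ dvd_mul_right d k)
  refine h.not_dvd_div h' ?_
  obtain ⟨c, hc⟩ := h'.dvd
  rw [hc, Nat.mul_div_cancel_left _ h'.prime.pos]
  refine Nat.Coprime.dvd_of_dvd_mul_left ?_ (hc ▸ h2)
  refine Nat.Coprime.symm ((Nat.Prime.coprime_iff_not_dvd h'.prime).2 fun hd => ?_)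
  have : p' ≤ p := by exact_mod_cast h.smooth p' h'.prime hd
  omega

lemma IsGreedy.unique {D p d k p' d' k' : ℕ} (h : IsGreedy D p d k)
    (h' : IsGreedy D p' d' k') (he : d * k = d' * k') : p = p' ∧ d = d' ∧ k = k' := by
  obtain rfl : p = p' := le_antisymm (h'.prime_le h he.symm) (h.prime_le h' he)
  have hd0 : d ≠ 0 := by have := h.lt; omega
  have hd0' : d' ≠ 0 := by have := h'.lt; omega
  obtain ⟨i, s, hs, hds⟩ := Nat.exists_eq_pow_mul_and_not_dvd hd0 p h.prime.ne_one
  obtain ⟨j, t, ht, hdt⟩ := Nat.exists_eq_pow_mul_and_not_dvd hd0' p h.prime.ne_one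
  have hcop : ∀ u, ¬ p ∣ u → ∀ l, u.Coprime (p ^ l) := fun u hu l =>
    Nat.Coprime.pow_right _ (Nat.Coprime.symm ((Nat.Prime.coprime_iff_not_dvd h.prime).2 hu))
  have hsd : s ∣ d := hds ▸ dvd_mul_left _ _
  have htd : t ∣ d' := hdt ▸ dvd_mul_left _ _
  have hst : s ∣ t := by
    have h1 : s ∣ d' := (h.coprime_of_lt h' hsd (Or.inr ⟨rfl, hs⟩)).dvd_of_dvd_mul_right
      (he ▸ hsd.mul_right k)
    exact (hcop s hs j).dvd_of_dvd_mul_left (hdt ▸ h1)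
  have hts : t ∣ s := by
    have h1 : t ∣ d := (h'.coprime_of_lt h htd (Or.inr ⟨rfl, ht⟩)).dvd_of_dvd_mul_right
      (he ▸ htd.mul_right k')
    exact (hcop t ht i).dvd_of_dvd_mul_left (hds ▸ h1)
  obtain rfl := Nat.dvd_antisymm hst hts
  have hdvd : ∀ a b, a < b → p ^ a * s ∣ p ^ b * s / p := by
    intro a b hab
    obtain ⟨c, rfl⟩ : ∃ c, b = a + c + 1 := ⟨b - a - 1, by omega⟩
    have : p ^ (a + c + 1) * s = p * (p ^ a * s * p ^ c) := by ring
    rw [this, Nat.mul_div_cancel_left _ h.prime.pos]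
    exact dvd_mul_right _ _
  have hij : i = j := by
    rcases lt_trichotomy i j with hlt | heq | hgt
    · exact absurd (by rw [hds, hdt]; exact hdvd i j hlt) (h.not_dvd_div h')
    · exact heq
    · exact absurd (by rw [hds, hdt]; exact hdvd j i hgt) (h'.not_dvd_div h)
  subst hij
  have hdd : d = d' := hds.trans hdt.symm
  subst hdd
  exact ⟨rfl, rfl, Nat.eq_of_mul_eq_mul_left (Nat.pos_of_ne_zero hd0) he⟩

lemma IsGreedy.le_mul {D p d k : ℕ} (h : IsGreedy D p d k) : d ≤ D * p := by
  rw [← Nat.div_mul_cancel h.dvd]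
  exact Nat.mul_le_mul_right _ h.div_le

/-- Every smooth number factors as `e * m` with `m` of prescribed size, unless `e = 1`. -/
lemma exists_factorization {y : ℝ} {M n : ℕ} (hM : 1 ≤ M) (hn : 1 ≤ n) (hs : IsSmooth y n) :
    ∃ e m : ℕ, n = e * m ∧ 1 ≤ e ∧ (m : ℝ) ≤ max 1 y * M ∧ (e = 1 ∨ M < m) := by
  rcases le_or_gt n M with h | h
  · refine ⟨1, n, by simp, le_rfl, ?_, Or.inl rfl⟩
    have : (n : ℝ) ≤ M := by exact_mod_cast h
    nlinarith [le_max_left 1 y, (Nat.cast_nonneg M : (0 : ℝ) ≤ M)]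
  · obtain ⟨p, d, k, hmk, hg⟩ := exists_isGreedy hM n h
    refine ⟨k, d, by rw [hmk, mul_comm], ?_, ?_, Or.inr hg.lt⟩
    · exact Nat.pos_of_ne_zero fun hk => by simp [hk] at hmk; omega
    · have h1 : (d : ℝ) ≤ M * p := by exact_mod_cast hg.le_mul
      have h2 : (p : ℝ) ≤ max 1 y :=
        (hs p hg.prime (hmk ▸ hg.dvd.mul_right k)).trans (le_max_right _ _)
      nlinarith [(Nat.cast_nonneg M : (0 : ℝ) ≤ M)]

/-- The exponential sum over smooth numbers splits into few bilinear sums. -/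
lemma exists_bilinear_decomposition (α : ℝ) {y : ℝ} {D N : ℕ} (hD : 1 ≤ D) :
    ∃ A B : ℕ → Finset ℕ, (∀ p, A p ⊆ Finset.Ioc D (D * ⌊y⌋₊)) ∧
      (∀ p, A p ⊆ smoothUpTo y (D * ⌊y⌋₊)) ∧ (∀ p, B p ⊆ smoothUpTo y (N / D)) ∧
      ‖∑ m ∈ smoothUpTo y N, e2pi (α * m)‖ ≤ D + ∑ p ∈ Finset.range (⌊y⌋₊ + 1),
        ‖∑ d ∈ A p, ∑ k ∈ (B p).filter (fun k => d * k ≤ N), e2pi (α * (d * k : ℕ))‖ := by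
  set A : ℕ → Finset ℕ := fun p => (Finset.Ioc D (D * ⌊y⌋₊)).filter
    fun d => p.Prime ∧ p ∣ d ∧ d / p ≤ D ∧ IsSmooth p d ∧ (p : ℝ) ≤ y with hA
  set B : ℕ → Finset ℕ := fun p => (smoothUpTo y (N / D)).filter
    fun k => ∀ r : ℕ, r.Prime → r ∣ k → p ≤ r with hB
  refine ⟨A, B, fun p => Finset.filter_subset _ _, fun p d hd => ?_,
    fun p => Finset.filter_subset _ _, ?_⟩
  · simp only [hA, Finset.mem_filter, Finset.mem_Ioc] at hd
    rw [mem_smoothUpTo]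
    exact ⟨by omega, hd.1.2, fun r hr hrd => (hd.2.2.2.2.1 r hr hrd).trans hd.2.2.2.2.2⟩
  have hsplit := Finset.sum_filter_add_sum_filter_not (smoothUpTo y N) (fun m => m ≤ D)
    (fun m => e2pi (α * m))
  rw [← hsplit]
  refine (norm_add_le _ _).trans (add_le_add ?_ ?_)
  · refine (norm_sum_e2pi_mul_le_card _ (fun m => α * m)).trans ?_
    have : (smoothUpTo y N).filter (fun m => m ≤ D) ⊆ Finset.Icc 1 D := fun m hm => by
      rw [Finset.mem_filter, mem_smoothUpTo] at hm
      exact Finset.mem_Icc.2 ⟨hm.1.1, hm.2⟩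
    have h2 := Finset.card_le_card this
    rw [Nat.card_Icc] at h2
    exact_mod_cast h2
  · refine le_trans (le_of_eq ?_) (norm_sum_le _ _)
    congr 1
    simp_rw [Finset.sum_filter (s := B _), ← Finset.sum_product', ← Finset.sum_filter]
    rw [Finset.sum_sigma']
    symm
    refine Finset.sum_bij (fun x _ => x.2.1 * x.2.2) ?_ ?_ ?_ ?_
    · rintro ⟨p, d, k⟩ hx
      simp only [hA, hB, Finset.mem_sigma, Finset.mem_range, Finset.mem_filter, Finset.mem_product,
        Finset.mem_Ioc, mem_smoothUpTo] at hx ⊢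
      obtain ⟨-, ⟨⟨⟨hd1, -⟩, -, -, -, hsd, hpy⟩, ⟨hk1, -, hsk⟩, -⟩, hdk⟩ := hx
      refine ⟨⟨Nat.mul_pos (by omega) hk1, hdk, IsSmooth.mul ?_ hsk⟩, ?_⟩
      · exact fun r hr hrd => (hsd r hr hrd).trans hpy
      · have := Nat.le_mul_of_pos_right d hk1
        omega
    · rintro ⟨p, d, k⟩ hx ⟨p', d', k'⟩ hx' he
      simp only [hA, hB, Finset.mem_sigma, Finset.mem_range, Finset.mem_filter, Finset.mem_product,
        Finset.mem_Ioc, mem_smoothUpTo] at hx hx' he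
      obtain ⟨-, ⟨⟨⟨hd1, -⟩, hp, hpd, hdp, hsd, -⟩, -, hr⟩, -⟩ := hx
      obtain ⟨-, ⟨⟨⟨hd1', -⟩, hp', hpd', hdp', hsd', -⟩, -, hr'⟩, -⟩ := hx'
      obtain ⟨rfl, rfl, rfl⟩ := IsGreedy.unique (D := D) ⟨hp, hpd, hd1, hdp, hsd, hr⟩
        ⟨hp', hpd', hd1', hdp', hsd', hr'⟩ he
      rfl
    · intro m hm
      simp only [Finset.mem_filter, mem_smoothUpTo, not_le] at hm
      obtain ⟨⟨hm1, hmN, hms⟩, hDm⟩ := hm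
      obtain ⟨p, d, k, rfl, hg⟩ := exists_isGreedy hD m hDm
      have hpy := hms p hg.prime (hg.dvd.mul_right k)
      have hpf : p ≤ ⌊y⌋₊ := Nat.le_floor hpy
      have hk : 1 ≤ k := Nat.pos_of_ne_zero fun hk => by simp [hk] at hm1
      refine ⟨⟨p, d, k⟩, ?_, rfl⟩
      simp only [hA, hB, Finset.mem_sigma, Finset.mem_range, Finset.mem_filter, Finset.mem_product,
        Finset.mem_Ioc, mem_smoothUpTo]
      refine ⟨by omega, ⟨⟨⟨hg.lt, hg.le_mul.trans (Nat.mul_le_mul_left _ hpf)⟩, hg.prime, hg.dvd,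
        hg.div_le, hg.smooth, hpy⟩, ⟨hk, ?_, hms.of_dvd (dvd_mul_left _ _)⟩, hg.rough⟩, hmN⟩
      rw [Nat.le_div_iff_mul_le (by omega), mul_comm]
      exact (Nat.mul_le_mul_right _ hg.lt.le).trans hmN
    · rintro ⟨p, d, k⟩ hx
      rfl

/-! ### Smooth numbers `k` with `α k` close to a given point modulo one -/

lemma card_le_of_dvd_sub {M : Finset ℕ} {h : ℕ} {L : ℝ} (hh : 1 ≤ h) (hL : 0 ≤ L)
    (H : ∀ m ∈ M, ∀ n ∈ M, m ≤ n → h ∣ n - m ∧ ((n - m : ℕ) : ℝ) ≤ L) :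
    (M.card : ℝ) ≤ 1 + L / h := by
  have hh0 : (0 : ℝ) < h := by exact_mod_cast hh
  rcases M.eq_empty_or_nonempty with rfl | hne
  · simp; positivity
  · have hsub : M ⊆ (Finset.range (⌊L / h⌋₊ + 1)).image fun i => M.min' hne + h * i := by
      intro n hn
      have hle := M.min'_le n hn
      obtain ⟨⟨i, hi⟩, hl⟩ := H _ (M.min'_mem hne) n hn hle
      refine Finset.mem_image.2 ⟨i, Finset.mem_range.2 (Nat.lt_succ_of_le ?_), by omega⟩
      refine Nat.le_floor ?_
      rw [le_div_iff₀ hh0]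
      rw [hi] at hl
      push_cast at hl
      linarith
    have h1 := (Finset.card_le_card hsub).trans Finset.card_image_le
    rw [Finset.card_range] at h1
    have h2 : (⌊L / h⌋₊ : ℝ) ≤ L / h := Nat.floor_le (by positivity)
    have h3 : (M.card : ℝ) ≤ ⌊L / h⌋₊ + 1 := by exact_mod_cast h1
    linarith

lemma one_div_le_norm_div {q : ℕ} {j : ℤ} (hq : 1 ≤ q) (hj : ¬ (q : ℤ) ∣ j) :
    1 / (q : ℝ) ≤ ‖((j / q : ℝ) : UnitAddCircle)‖ := by
  have hq0 : (0 : ℝ) < q := by exact_mod_cast hq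
  rw [UnitAddCircle.norm_eq]
  set r := round (j / q : ℝ)
  have h1 : (j / q - r : ℝ) = ((j - r * q : ℤ) : ℝ) / q := by push_cast; field_simp
  rw [h1, abs_div, abs_of_pos hq0]
  gcongr
  have h2 : j - r * q ≠ 0 := fun h => hj ⟨r, by linarith⟩
  exact_mod_cast Int.one_le_abs h2

lemma coe_intCast_eq_zero (n : ℤ) : ((n : ℝ) : UnitAddCircle) = 0 :=
  (AddCircle.coe_eq_zero_iff 1).2 ⟨n, by simp⟩

/-- If `a / q` approximates `α` and `α t` is close to an integer with `t` not too large, then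
`q ∣ t` and in fact `t` is small. -/
lemma dvd_and_le_of_norm_mul_le {α B : ℝ} {a : ℤ} {q D N t : ℕ} (hq : 1 ≤ q)
    (hcop : IsCoprime a (q : ℤ)) (hB : |q * α - a| = B) (hBpos : 0 < B) (hqD : 4 * q ≤ D)
    (hDB : 4 * N * B ≤ D) (htN : t * D ≤ N) (ht : ‖((α * t : ℝ) : UnitAddCircle)‖ ≤ 2 / D) :
    q ∣ t ∧ (t : ℝ) ≤ 2 * q / (B * D) := by
  have hq0 : (0 : ℝ) < q := by exact_mod_cast hq
  have hqD' : (4 : ℝ) * q ≤ D := by exact_mod_cast hqD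
  have hD0 : (0 : ℝ) < D := by linarith
  have htN' : (t : ℝ) * D ≤ N := by exact_mod_cast htN
  set η : ℝ := t * (q * α - a) / q with hη
  have habs : |η| = t * B / q := by
    rw [hη, abs_div, abs_mul, hB, abs_of_pos hq0, abs_of_nonneg (Nat.cast_nonneg t)]
  have htB : t * B ≤ 1 / 4 := by
    have h1 : (t * D) * B ≤ N * B := mul_le_mul_of_nonneg_right htN' hBpos.le
    have h2 : D * (t * B) ≤ D * (1 / 4) := by linarith
    exact le_of_mul_le_mul_left h2 hD0
  have hdec : α * t = ((a * t : ℤ) : ℝ) / q + η := by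
    rw [hη]; push_cast; field_simp; ring
  have hηn : ‖((η : ℝ) : UnitAddCircle)‖ ≤ |η| := QuotientAddGroup.norm_mk_le_norm
  have hdiv : (q : ℤ) ∣ a * t := by
    by_contra hnd
    have h1 := one_div_le_norm_div hq hnd
    have h2 : ((((a * t : ℤ) : ℝ) / q : ℝ) : UnitAddCircle)
        = ((α * t : ℝ) : UnitAddCircle) - ((η : ℝ) : UnitAddCircle) := by
      rw [hdec, AddCircle.coe_add]; abel
    rw [h2] at h1
    have h3 := norm_sub_le ((α * t : ℝ) : UnitAddCircle) ((η : ℝ) : UnitAddCircle)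
    have h4 : (2 : ℝ) / D ≤ 2 / (4 * q) := by gcongr
    have h5 : |η| ≤ (1 / 4) / q := by rw [habs]; gcongr
    have h6 : (1 : ℝ) / q ≤ 2 / (4 * q) + (1 / 4) / q := by linarith
    have h7 : (2 : ℝ) / (4 * q) + (1 / 4) / q = (3 / 4) / q := by field_simp; norm_num
    rw [h7, div_le_div_iff_of_pos_right hq0] at h6
    norm_num at h6
  have hqt : (q : ℤ) ∣ t := hcop.symm.dvd_of_dvd_mul_left hdiv
  refine ⟨by exact_mod_cast hqt, ?_⟩
  have heq : ((α * t : ℝ) : UnitAddCircle) = ((η : ℝ) : UnitAddCircle) := by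
    obtain ⟨w, hw⟩ := hdiv
    rw [hdec, AddCircle.coe_add, hw]
    have : (((q * w : ℤ) : ℝ) / q : ℝ) = (w : ℝ) := by push_cast; field_simp
    rw [this, coe_intCast_eq_zero, zero_add]
  have hη4 : |η| ≤ 1 / 2 := by
    rw [habs, div_le_iff₀ hq0]
    have : (1 : ℝ) ≤ q := by exact_mod_cast hq
    linarith
  have hnorm : ‖((η : ℝ) : UnitAddCircle)‖ = |η| :=
    (AddCircle.norm_coe_eq_abs_iff (p := (1 : ℝ)) (x := η) one_ne_zero).2 (by simpa using hη4)
  rw [heq, hnorm, habs, div_le_div_iff₀ hq0 hD0] at ht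
  rw [le_div_iff₀ (by positivity)]
  linarith

/-- The `m ≤ Z` for which `α (e m)` is close to `γ` and `e m ≤ N / D` lie in a short segment of an
arithmetic progression. -/
lemma card_multipliers_le {α B γ Z : ℝ} {a : ℤ} {q D N e : ℕ} (hq : 1 ≤ q)
    (hcop : IsCoprime a (q : ℤ)) (hB : |q * α - a| = B) (hBpos : 0 < B) (hqD : 4 * q ≤ D)
    (hDB : 4 * N * B ≤ D) (he : 1 ≤ e) (hZ : 0 ≤ Z) {M : Finset ℕ}
    (hM : ∀ m ∈ M, (m : ℝ) ≤ Z ∧ e * m * D ≤ N ∧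
      ‖((α * (e * m : ℕ) - γ : ℝ) : UnitAddCircle)‖ ≤ 1 / D) :
    (M.card : ℝ) ≤ 1 + (e.gcd q / q : ℝ) * min Z (min ((N : ℝ) / D) (2 * q / (B * D)) / e) := by
  have hq0 : (0 : ℝ) < q := by exact_mod_cast hq
  have hD1 : 1 ≤ D := by omega
  have hD0 : (0 : ℝ) < D := by exact_mod_cast hD1
  have he0 : (0 : ℝ) < e := by exact_mod_cast he
  have hg : 0 < e.gcd q := Nat.gcd_pos_of_pos_left _ he
  have hgq : e.gcd q ∣ q := Nat.gcd_dvd_right _ _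
  have hL : 0 ≤ min Z (min ((N : ℝ) / D) (2 * q / (B * D)) / e) := by positivity
  have hh : 1 ≤ q / e.gcd q := Nat.div_pos (Nat.le_of_dvd hq hgq) hg
  refine (card_le_of_dvd_sub hh hL ?_).trans (le_of_eq ?_)
  · intro m hm n hn hmn
    obtain ⟨hm1, hm2, hm3⟩ := hM m hm
    obtain ⟨hn1, hn2, hn3⟩ := hM n hn
    have hle : e * (n - m) * D ≤ N := le_trans (by gcongr; exact Nat.sub_le _ _) hn2
    have hnorm : ‖((α * (e * (n - m) : ℕ) : ℝ) : UnitAddCircle)‖ ≤ 2 / D := by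
      have : α * (e * (n - m) : ℕ) = (α * (e * n : ℕ) - γ) - (α * (e * m : ℕ) - γ) := by
        rw [Nat.cast_mul, Nat.cast_sub hmn]; push_cast; ring
      rw [this, AddCircle.coe_sub]
      refine (norm_sub_le _ _).trans ?_
      calc _ ≤ 1 / (D : ℝ) + 1 / D := add_le_add hn3 hm3
        _ = 2 / D := by ring
    obtain ⟨h1, h2⟩ := dvd_and_le_of_norm_mul_le hq hcop hB hBpos hqD hDB hle hnorm
    constructor
    · refine Nat.Coprime.dvd_of_dvd_mul_left (k := q / e.gcd q) (m := e / e.gcd q) ?_ ?_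
      · exact (Nat.coprime_div_gcd_div_gcd hg).symm
      · have h3 := Nat.div_dvd_div hgq h1
        rwa [← Nat.div_mul_right_comm (Nat.gcd_dvd_left e q)] at h3
    · push_cast at h2
      refine le_min ?_ ?_
      · exact le_trans (by exact_mod_cast Nat.sub_le _ _) hn1
      · rw [le_div_iff₀ he0, mul_comm]
        refine le_min ?_ h2
        rw [le_div_iff₀ hD0]
        exact_mod_cast hle
  · rw [Nat.cast_div hgq (by positivity)]
    field_simp

/-- The Rankin sum `∑ e ^ (-σ)` over `y`-smooth `e ≤ N`. -/
def rankinSum (σ y : ℝ) (N : ℕ) : ℝ := ∑ e ∈ smoothUpTo y N, (e : ℝ) ^ (-σ)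

lemma rankinSum_nonneg (σ y : ℝ) (N : ℕ) : 0 ≤ rankinSum σ y N :=
  Finset.sum_nonneg fun _ _ => by positivity

lemma card_smoothUpTo_le {σ y Z : ℝ} {N E : ℕ} (hσ : 0 ≤ σ) (hEN : E ≤ N) (hEZ : (E : ℝ) ≤ Z) :
    ((smoothUpTo y E).card : ℝ) ≤ Z ^ σ * rankinSum σ y N := by
  have hZ : 0 ≤ Z := (Nat.cast_nonneg E).trans hEZ
  rw [rankinSum, Finset.mul_sum, Finset.cast_card]
  calc ∑ e ∈ smoothUpTo y E, (1 : ℝ) ≤ ∑ e ∈ smoothUpTo y E, Z ^ σ * (e : ℝ) ^ (-σ) := by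
        refine Finset.sum_le_sum fun e he => ?_
        rw [mem_smoothUpTo] at he
        have he0 : (0 : ℝ) < e := by exact_mod_cast he.1
        rw [Real.rpow_neg he0.le, ← div_eq_mul_inv, one_le_div (by positivity)]
        exact Real.rpow_le_rpow he0.le (le_trans (by exact_mod_cast he.2.1) hEZ) hσ
    _ ≤ _ := Finset.sum_le_sum_of_subset_of_nonneg (smoothUpTo_mono hEN) fun _ _ _ => by positivity

lemma sum_gcd_mul_rpow_le {σ y : ℝ} {N E q : ℕ} (hσ : σ ≤ 1) (hEN : E ≤ N) (hq : 1 ≤ q) :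
    ∑ e ∈ smoothUpTo y E, (e.gcd q : ℝ) * (e : ℝ) ^ (-σ) ≤
      q.divisors.card * (q : ℝ) ^ (1 - σ) * rankinSum σ y N := by
  have hmaps : ∀ e ∈ smoothUpTo y E, e.gcd q ∈ q.divisors := fun e _ =>
    Nat.mem_divisors.2 ⟨Nat.gcd_dvd_right _ _, by omega⟩
  rw [← Finset.sum_fiberwise_of_maps_to hmaps, mul_assoc, ← nsmul_eq_mul, ← Finset.sum_const]
  refine Finset.sum_le_sum fun g hg => ?_
  have hgq := Nat.dvd_of_mem_divisors hg
  have hg1 : 1 ≤ g := Nat.pos_of_dvd_of_pos hgq hq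
  have hg0 : (0 : ℝ) < g := by exact_mod_cast hg1
  have hgle : (g : ℝ) ≤ q := by exact_mod_cast Nat.le_of_dvd hq hgq
  calc ∑ e ∈ (smoothUpTo y E).filter (fun e => e.gcd q = g), (e.gcd q : ℝ) * (e : ℝ) ^ (-σ)
      = ∑ e ∈ (smoothUpTo y E).filter (fun e => e.gcd q = g),
          (g : ℝ) ^ (1 - σ) * ((e / g : ℕ) : ℝ) ^ (-σ) := by
        refine Finset.sum_congr rfl fun e he => ?_
        rw [Finset.mem_filter] at he
        have hge : g ∣ e := he.2 ▸ Nat.gcd_dvd_left _ _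
        rw [he.2, Nat.cast_div hge hg0.ne', Real.div_rpow (Nat.cast_nonneg _) hg0.le,
          sub_eq_add_neg, Real.rpow_add hg0, Real.rpow_one]
        field_simp
    _ = (g : ℝ) ^ (1 - σ) * ∑ e ∈ (smoothUpTo y E).filter (fun e => e.gcd q = g),
          ((e / g : ℕ) : ℝ) ^ (-σ) := by rw [Finset.mul_sum]
    _ ≤ (q : ℝ) ^ (1 - σ) * rankinSum σ y N := by
        refine mul_le_mul (Real.rpow_le_rpow hg0.le hgle (by linarith)) ?_
          (Finset.sum_nonneg fun _ _ => by positivity) (by positivity)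
        rw [rankinSum, ← Finset.sum_image (f := fun n : ℕ => (n : ℝ) ^ (-σ))
          (g := fun e : ℕ => e / g)]
        · refine Finset.sum_le_sum_of_subset_of_nonneg ?_ fun _ _ _ => by positivity
          intro n hn
          obtain ⟨e, he, rfl⟩ := Finset.mem_image.1 hn
          rw [Finset.mem_filter, mem_smoothUpTo] at he
          have hge : g ∣ e := he.2 ▸ Nat.gcd_dvd_left _ _
          exact mem_smoothUpTo.2 ⟨Nat.div_pos (Nat.le_of_dvd he.1.1 hge) hg1,
            (Nat.div_le_self _ _).trans (he.1.2.1.trans hEN), he.1.2.2.of_dvd (Nat.div_dvd_of_dvd hge)⟩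
        · intro e he e' he' hee
          simp only [Finset.coe_filter, Set.mem_ofPred_eq] at he he'
          have hge : g ∣ e := he.2 ▸ Nat.gcd_dvd_left _ _
          have hge' : g ∣ e' := he'.2 ▸ Nat.gcd_dvd_left _ _
          exact (Nat.div_left_inj hge hge').1 hee

/-- The number of smooth `k ≤ N / D` with `α k` within `1 / D` of `γ` modulo one. -/
lemma card_near_le {α B γ y σ : ℝ} {a : ℤ} {q D N : ℕ} (hq : 1 ≤ q)
    (hcop : IsCoprime a (q : ℤ)) (hB : |q * α - a| = B) (hBpos : 0 < B) (hqD : 4 * q ≤ D)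
    (hDB : 4 * N * B ≤ D) (hDup : (D : ℝ) ≤ 8 * max (q : ℝ) (N * B)) (hDN : (D : ℝ) ^ 2 ≤ 64 * N)
    (hy : 1 ≤ y) (hσ0 : 0 ≤ σ) (hσ1 : σ ≤ 1) :
    (((smoothUpTo y (N / D)).filter
      fun k : ℕ => ‖((α * k - γ : ℝ) : UnitAddCircle)‖ ≤ 1 / D).card : ℝ) ≤
      80 * y * q.divisors.card * rankinSum σ y N * (N : ℝ) ^ σ * (D : ℝ) ^ (1 - 3 * σ) := by
  have hq0 : (0 : ℝ) < q := by exact_mod_cast hq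
  have hD1 : 1 ≤ D := by omega
  have hD0 : (0 : ℝ) < D := by exact_mod_cast hD1
  have hD1' : (1 : ℝ) ≤ D := by exact_mod_cast hD1
  have hN0 : (0 : ℝ) < N := by nlinarith
  have hN1 : 1 ≤ N := by exact_mod_cast hN0
  set K := N / D with hK
  set E := max 1 (K / D) with hE
  set τ : ℝ := (q.divisors.card : ℝ) with hτ
  set R := rankinSum σ y N with hR
  have hR0 : 0 ≤ R := rankinSum_nonneg _ _ _
  have hEN : E ≤ N := max_le hN1 ((Nat.div_le_self _ _).trans (Nat.div_le_self _ _))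
  have hEZ : (E : ℝ) ≤ 64 * (N / D ^ 2) := by
    rw [hE, Nat.cast_max, Nat.cast_one]
    have h1 : (1 : ℝ) ≤ 64 * (N / D ^ 2) := by
      rw [← mul_div_assoc, one_le_div (by positivity)]; exact hDN
    refine max_le h1 ?_
    have h2 : ((K / D : ℕ) : ℝ) ≤ N / D ^ 2 := by
      rw [hK, Nat.div_div_eq_div_mul, sq]
      exact_mod_cast (Nat.cast_div_le (α := ℝ) (m := N) (n := D * D))
    have h3 : (0 : ℝ) ≤ N / D ^ 2 := by positivity
    linarith
  set W := min ((N : ℝ) / D) (2 * q / (B * D)) with hW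
  have hW0 : 0 ≤ W := by positivity
  have hWle : W ≤ 16 * (q * (N / D ^ 2)) := by
    rcases max_cases (q : ℝ) (N * B) with ⟨h, -⟩ | ⟨h, -⟩
    · rw [h] at hDup
      refine (min_le_left _ _).trans ?_
      rw [← mul_div_assoc, ← mul_div_assoc, div_le_div_iff₀ hD0 (by positivity)]
      nlinarith [mul_pos hN0 hD0, mul_pos (mul_pos hN0 hD0) hq0,
        mul_le_mul_of_nonneg_left hDup (mul_pos hN0 hD0).le]
    · rw [h] at hDup
      refine (min_le_right _ _).trans ?_
      rw [← mul_div_assoc, ← mul_div_assoc, div_le_div_iff₀ (by positivity) (by positivity)]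
      nlinarith [mul_le_mul_of_nonneg_left hDup (mul_pos hq0 hD0).le]
  set Z := y * D with hZ
  have hZ0 : 0 < Z := by positivity
  set M : ℕ → Finset ℕ := fun e => (Finset.Icc 1 ⌊Z⌋₊).filter fun m =>
    e * m * D ≤ N ∧ ‖((α * (e * m : ℕ) - γ : ℝ) : UnitAddCircle)‖ ≤ 1 / D with hM
  have hcover : (smoothUpTo y K).filter
      (fun k : ℕ => ‖((α * k - γ : ℝ) : UnitAddCircle)‖ ≤ 1 / D) ⊆
      (smoothUpTo y E).biUnion fun e => (M e).image fun m => e * m := by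
    intro k hk
    rw [Finset.mem_filter, mem_smoothUpTo] at hk
    obtain ⟨⟨hk1, hkK, hks⟩, hkn⟩ := hk
    obtain ⟨e, m, rfl, he1, hmZ, hem⟩ := exists_factorization hD1 hk1 hks
    rw [max_eq_right hy] at hmZ
    have hm1 : 1 ≤ m := Nat.pos_of_ne_zero fun h => by simp [h] at hk1
    rw [Finset.mem_biUnion]
    refine ⟨e, mem_smoothUpTo.2 ⟨he1, ?_, hks.of_dvd (dvd_mul_right _ _)⟩, ?_⟩
    · rcases hem with h | h
      · exact h ▸ le_max_left _ _
      · refine le_trans ?_ (le_max_right _ _)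
        rw [Nat.le_div_iff_mul_le hD1]
        exact (Nat.mul_le_mul_left _ h.le).trans hkK
    · refine Finset.mem_image.2 ⟨m, ?_, rfl⟩
      rw [hM, Finset.mem_filter, Finset.mem_Icc]
      exact ⟨⟨hm1, Nat.le_floor hmZ⟩, (Nat.le_div_iff_mul_le hD1).1 hkK, hkn⟩
  set P : ℝ := (N : ℝ) ^ σ * (D : ℝ) ^ (1 - 3 * σ) with hP
  have hP0 : 0 ≤ P := by positivity
  have hND : ((N : ℝ) / D ^ 2) ^ σ = (N : ℝ) ^ σ * (D : ℝ) ^ (-2 * σ) := by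
    rw [Real.div_rpow hN0.le (by positivity), ← Real.rpow_natCast, ← Real.rpow_mul hD0.le,
      div_eq_mul_inv, ← Real.rpow_neg hD0.le]
    norm_num
  have hpow : ∀ x : ℝ, 1 ≤ x → x ^ σ ≤ x := fun x hx => by
    simpa using Real.rpow_le_rpow_of_exponent_le hx hσ1
  have hcard : ∀ e ∈ smoothUpTo y E, ((M e).card : ℝ) ≤ 1 +
      (16 * y * (q : ℝ) ^ (σ - 1) * P) * ((e.gcd q : ℝ) * (e : ℝ) ^ (-σ)) := by
    intro e he
    rw [mem_smoothUpTo] at he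
    have he0 : (0 : ℝ) < e := by exact_mod_cast he.1
    refine (card_multipliers_le (γ := γ) (Z := Z) hq hcop hB hBpos hqD hDB he.1 hZ0.le ?_).trans ?_
    · intro m hm
      rw [hM, Finset.mem_filter, Finset.mem_Icc] at hm
      exact ⟨(Nat.le_floor_iff hZ0.le).1 hm.1.2, hm.2⟩
    have hmin : min Z (W / e) ≤ Z ^ (1 - σ) * (W / e) ^ σ := by
      have hm0 : 0 ≤ min Z (W / e) := by positivity
      rcases hm0.eq_or_lt with h0 | h0
      · rw [← h0]; positivity
      calc min Z (W / e) = (min Z (W / e)) ^ (1 - σ) * (min Z (W / e)) ^ σ := by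
            rw [← Real.rpow_add h0]; simp
        _ ≤ _ := mul_le_mul (Real.rpow_le_rpow hm0 (min_le_left _ _) (by linarith))
            (Real.rpow_le_rpow hm0 (min_le_right _ _) hσ0) (by positivity) (by positivity)
    have hW2 : (W / e) ^ σ ≤ 16 * ((q : ℝ) ^ σ * ((N : ℝ) ^ σ * (D : ℝ) ^ (-2 * σ))) * (e : ℝ) ^ (-σ) := by
      rw [Real.div_rpow hW0 he0.le, Real.rpow_neg he0.le, div_eq_mul_inv]
      gcongr
      calc W ^ σ ≤ (16 * (q * (N / D ^ 2))) ^ σ := Real.rpow_le_rpow hW0 hWle hσ0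
        _ = (16 : ℝ) ^ σ * ((q : ℝ) ^ σ * ((N : ℝ) ^ σ * (D : ℝ) ^ (-2 * σ))) := by
          rw [Real.mul_rpow (by norm_num) (by positivity), Real.mul_rpow hq0.le (by positivity), hND]
        _ ≤ _ := by gcongr; exact hpow 16 (by norm_num)
    have hZ2 : Z ^ (1 - σ) ≤ y * (D : ℝ) ^ (1 - σ) := by
      rw [hZ, Real.mul_rpow (by linarith) hD0.le]
      gcongr
      simpa using Real.rpow_le_rpow_of_exponent_le hy (show 1 - σ ≤ 1 by linarith)
    have hDD : (D : ℝ) ^ (1 - σ) * (D : ℝ) ^ (-2 * σ) = (D : ℝ) ^ (1 - 3 * σ) := by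
      rw [← Real.rpow_add hD0]; ring_nf
    have hqq : (q : ℝ) ^ (σ - 1) = (q : ℝ) ^ σ / q := by
      rw [Real.rpow_sub hq0, Real.rpow_one]
    refine add_le_add_right ?_ 1
    calc (e.gcd q / q : ℝ) * min Z (W / e)
        ≤ (e.gcd q / q : ℝ) * ((y * (D : ℝ) ^ (1 - σ)) *
            (16 * ((q : ℝ) ^ σ * ((N : ℝ) ^ σ * (D : ℝ) ^ (-2 * σ))) * (e : ℝ) ^ (-σ))) := by
          gcongr
          exact hmin.trans (mul_le_mul hZ2 hW2 (by positivity) (by positivity))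
      _ = _ := by rw [hP, ← hDD, hqq]; ring
  have hE1 : ((smoothUpTo y E).card : ℝ) ≤ 64 * P * R := by
    refine (card_smoothUpTo_le hσ0 hEN hEZ).trans ?_
    rw [Real.mul_rpow (by norm_num) (by positivity), hND]
    gcongr
    · exact hpow 64 (by norm_num)
    · rw [hP]
      exact mul_le_mul_of_nonneg_left
        (Real.rpow_le_rpow_of_exponent_le hD1' (by linarith)) (by positivity)
  have hqq : (q : ℝ) ^ (σ - 1) * (q : ℝ) ^ (1 - σ) = 1 := by
    rw [← Real.rpow_add hq0]; simp
  have hτ1 : 1 ≤ τ := by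
    rw [hτ]; exact_mod_cast Finset.card_pos.2 ⟨1, Nat.one_mem_divisors.2 (by omega)⟩
  calc _ ≤ ∑ e ∈ smoothUpTo y E, ((M e).card : ℝ) := by
        have h1 := (Finset.card_le_card hcover).trans Finset.card_biUnion_le
        have h2 := h1.trans (Finset.sum_le_sum fun e _ => Finset.card_image_le)
        exact_mod_cast h2
    _ ≤ ∑ e ∈ smoothUpTo y E, (1 +
      (16 * y * (q : ℝ) ^ (σ - 1) * P) * ((e.gcd q : ℝ) * (e : ℝ) ^ (-σ))) :=
        Finset.sum_le_sum hcard
    _ = (smoothUpTo y E).card + (16 * y * (q : ℝ) ^ (σ - 1) * P) *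
          ∑ e ∈ smoothUpTo y E, ((e.gcd q : ℝ) * (e : ℝ) ^ (-σ)) := by
        rw [Finset.sum_add_distrib, Finset.mul_sum]; simp
    _ ≤ 64 * P * R + (16 * y * (q : ℝ) ^ (σ - 1) * P) * (τ * (q : ℝ) ^ (1 - σ) * R) := by
        gcongr
        exact sum_gcd_mul_rpow_le hσ1 hEN hq
    _ = 64 * P * R + 16 * (y * τ) * P * R := by
        linear_combination (16 * y * P * τ * R) * hqq
    _ ≤ 64 * (y * τ) * P * R + 16 * (y * τ) * P * R := by
        have : 1 ≤ y * τ := one_le_mul_of_one_le_of_one_le hy hτ1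
        have h2 : 0 ≤ P * R := by positivity
        nlinarith
    _ = _ := by rw [hP]; ring

/-- The divisor bound. -/
lemma exists_card_divisors_le {ε : ℝ} (hε : 0 < ε) :
    ∃ C : ℝ, 0 < C ∧ ∀ q : ℕ, 1 ≤ q → (q.divisors.card : ℝ) ≤ C * (q : ℝ) ^ ε := by
  set K : ℕ := ⌈(2 : ℝ) ^ (1 / ε)⌉₊ with hK
  have hl2 : 0 < Real.log 2 := Real.log_pos one_lt_two
  set C₀ : ℝ := max 1 (1 / (ε * Real.log 2)) with hC₀
  have hC₀1 : 1 ≤ C₀ := le_max_left _ _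
  have hC₀2 : 1 ≤ C₀ * (ε * Real.log 2) := by
    have := le_max_right 1 (1 / (ε * Real.log 2))
    rw [← hC₀, div_le_iff₀ (by positivity)] at this
    exact this
  refine ⟨C₀ ^ K, by positivity, fun q hq => ?_⟩
  have hlocal : ∀ p ∈ q.primeFactors, ((q.factorization p + 1 : ℕ) : ℝ) ≤
      (if p < K then C₀ else 1) * ((p ^ q.factorization p : ℕ) : ℝ) ^ ε := by
    intro p hp
    set a := q.factorization p
    have hp2 : (2 : ℝ) ≤ p := by exact_mod_cast (Nat.prime_of_mem_primeFactors hp).two_le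
    have hpa : ((p ^ a : ℕ) : ℝ) ^ ε = ((p : ℝ) ^ ε) ^ a := by
      rw [Nat.cast_pow, ← Real.rpow_natCast, ← Real.rpow_natCast, ← Real.rpow_mul (by linarith),
        ← Real.rpow_mul (by linarith), mul_comm]
    rw [hpa]
    split_ifs with h
    · have h1 : (2 : ℝ) ^ ε ≤ (p : ℝ) ^ ε := Real.rpow_le_rpow zero_le_two hp2 hε.le
      have h2 : 1 + (a : ℝ) * (ε * Real.log 2) ≤ ((2 : ℝ) ^ ε) ^ a := by
        rw [← Real.rpow_natCast, ← Real.rpow_mul zero_le_two, Real.rpow_def_of_pos two_pos]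
        have := Real.add_one_le_exp (Real.log 2 * (ε * a))
        linarith
      calc ((a + 1 : ℕ) : ℝ) ≤ C₀ * (1 + (a : ℝ) * (ε * Real.log 2)) := by
            push_cast
            nlinarith [mul_le_mul_of_nonneg_left hC₀2 (Nat.cast_nonneg (α := ℝ) a)]
        _ ≤ C₀ * ((p : ℝ) ^ ε) ^ a := by
            gcongr
            exact h2.trans (pow_le_pow_left₀ (by positivity) h1 a)
    · have h1 : (2 : ℝ) ≤ (p : ℝ) ^ ε := by
        have h3 : (2 : ℝ) ^ (1 / ε) ≤ p := by
          push Not at h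
          exact (Nat.le_ceil _).trans (by exact_mod_cast h)
        calc (2 : ℝ) = ((2 : ℝ) ^ (1 / ε)) ^ ε := by
              rw [← Real.rpow_mul zero_le_two, one_div_mul_cancel hε.ne', Real.rpow_one]
          _ ≤ _ := Real.rpow_le_rpow (by positivity) h3 hε.le
      rw [one_mul]
      calc ((a + 1 : ℕ) : ℝ) ≤ (2 : ℝ) ^ a := by exact_mod_cast Nat.lt_two_pow_self
        _ ≤ _ := pow_le_pow_left₀ zero_le_two h1 a
  rw [Nat.card_divisors (by omega)]
  calc ((∏ p ∈ q.primeFactors, (q.factorization p + 1) : ℕ) : ℝ)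
      ≤ ∏ p ∈ q.primeFactors,
        ((if p < K then C₀ else 1) * ((p ^ q.factorization p : ℕ) : ℝ) ^ ε) := by
        rw [Nat.cast_prod]
        exact Finset.prod_le_prod (fun _ _ => by positivity) hlocal
    _ = (∏ p ∈ q.primeFactors, if p < K then C₀ else 1) * (q : ℝ) ^ ε := by
        rw [Finset.prod_mul_distrib, Real.finsetProd_rpow _ _ fun _ _ => by positivity,
          ← Nat.cast_prod]
        congr 3
        exact_mod_cast Nat.prod_factorization_pow_eq_self (n := q) (by omega)
    _ ≤ C₀ ^ K * (q : ℝ) ^ ε := by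
        gcongr
        rw [Finset.prod_ite, Finset.prod_const, Finset.prod_const_one, mul_one]
        refine pow_le_pow_right₀ hC₀1 ?_
        calc _ ≤ (Finset.range K).card := Finset.card_le_card fun p hp => by
              simpa using (Finset.mem_filter.1 hp).2
          _ = K := Finset.card_range K

lemma isSmooth_iff_mem_smoothNumbers {y : ℝ} (hy : 0 ≤ y) {n : ℕ} :
    IsSmooth y n ↔ n ∈ Nat.smoothNumbers (⌊y⌋₊ + 1) := by
  rw [Nat.mem_smoothNumbers']
  exact forall_congr' fun p => by
    refine ⟨fun h hp hd => Nat.lt_succ_of_le (Nat.le_floor (h hp hd)), fun h hp hd => ?_⟩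
    exact (Nat.le_floor_iff hy).1 (Nat.le_of_lt_succ (h hp hd))

lemma sum_Icc_inv_le_one_add_log {y : ℝ} (hy : 1 ≤ y) :
    ∑ n ∈ Finset.Icc 1 ⌊y⌋₊, ((n : ℝ))⁻¹ ≤ 1 + Real.log y := by
  have h := harmonic_floor_le_one_add_log y hy
  rw [harmonic_eq_sum_Icc] at h
  push_cast at h
  exact h

/-- Euler product bound for the Rankin sum. -/
lemma rankinSum_le_exp {σ y : ℝ} (N : ℕ) (hσ : 1 / 2 ≤ σ) (hσ1 : σ ≤ 1) (hy : 1 ≤ y) :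
    rankinSum σ y N ≤ Real.exp (4 * (y ^ (1 - σ) * (1 + Real.log y))) := by
  have hσ0 : 0 < σ := by linarith
  let f : ℕ →* ℝ :=
    { toFun := fun n => (n : ℝ) ^ (-σ)
      map_one' := by simp
      map_mul' := fun m n => by
        rw [Nat.cast_mul, Real.mul_rpow (Nat.cast_nonneg m) (Nat.cast_nonneg n)] }
  have hfdef : ∀ n : ℕ, f n = (n : ℝ) ^ (-σ) := fun _ => rfl
  have hf0 : ∀ n : ℕ, 0 ≤ f n := fun n => by rw [hfdef]; positivity
  have hfp : ∀ p : ℕ, p.Prime → f p ≤ 3 / 4 := by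
    intro p hp
    have hp2 : (2 : ℝ) ≤ p := by exact_mod_cast hp.two_le
    rw [hfdef, Real.rpow_neg (by linarith)]
    have h1 : (4 / 3 : ℝ) ≤ (p : ℝ) ^ σ := by
      calc (4 / 3 : ℝ) ≤ (2 : ℝ) ^ (1 / 2 : ℝ) := by
            rw [← Real.sqrt_eq_rpow]
            exact Real.le_sqrt_of_sq_le (by norm_num)
        _ ≤ (2 : ℝ) ^ σ := Real.rpow_le_rpow_of_exponent_le one_le_two hσ
        _ ≤ _ := Real.rpow_le_rpow zero_le_two hp2 hσ0.le
    rw [inv_le_comm₀ (by positivity) (by norm_num)]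
    norm_num at h1 ⊢
    exact h1
  obtain ⟨hsum, hprod⟩ :=
    EulerProduct.summable_and_hasSum_smoothNumbers_prod_primesBelow_geometric (f := f)
      (fun {p} hp => by
        rw [Real.norm_of_nonneg (hf0 p)]
        linarith [hfp p hp]) (⌊y⌋₊ + 1)
  have hle : rankinSum σ y N ≤ ∏ p ∈ (⌊y⌋₊ + 1).primesBelow, (1 - f p)⁻¹ := by
    rw [rankinSum, ← hprod.tsum_eq]
    have hmem : ∀ n ∈ smoothUpTo y N, n ∈ Nat.smoothNumbers (⌊y⌋₊ + 1) := fun n hn => by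
      rw [mem_smoothUpTo] at hn
      exact (isSmooth_iff_mem_smoothNumbers (by linarith)).1 hn.2.2
    rw [← Finset.sum_subtype_of_mem (p := (· ∈ Nat.smoothNumbers (⌊y⌋₊ + 1)))
      (fun n : ℕ => (n : ℝ) ^ (-σ)) hmem]
    exact hprod.summable.sum_le_tsum _ fun _ _ => hf0 _
  refine hle.trans ?_
  calc ∏ p ∈ (⌊y⌋₊ + 1).primesBelow, (1 - f p)⁻¹
      ≤ ∏ p ∈ (⌊y⌋₊ + 1).primesBelow, Real.exp (4 * f p) := by
        refine Finset.prod_le_prod (fun p hp => ?_) fun p hp => ?_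
        · have := hfp p (Nat.prime_of_mem_primesBelow hp)
          exact inv_nonneg.2 (by linarith)
        · have h1 := hfp p (Nat.prime_of_mem_primesBelow hp)
          have h2 := hf0 p
          refine le_trans ?_ (Real.add_one_le_exp _)
          rw [inv_le_iff_one_le_mul₀ (by linarith)]
          nlinarith
    _ = Real.exp (4 * ∑ p ∈ (⌊y⌋₊ + 1).primesBelow, f p) := by
        rw [← Real.exp_sum, Finset.mul_sum]
    _ ≤ _ := by
        gcongr
        calc ∑ p ∈ (⌊y⌋₊ + 1).primesBelow, f p ≤ ∑ n ∈ Finset.Icc 1 ⌊y⌋₊, f n := by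
              refine Finset.sum_le_sum_of_subset_of_nonneg (fun p hp => ?_) fun _ _ _ => hf0 _
              exact Finset.mem_Icc.2 ⟨(Nat.prime_of_mem_primesBelow hp).one_le,
                Nat.le_of_lt_succ (Nat.lt_of_mem_primesBelow hp)⟩
          _ ≤ ∑ n ∈ Finset.Icc 1 ⌊y⌋₊, y ^ (1 - σ) * ((n : ℝ))⁻¹ := by
              refine Finset.sum_le_sum fun n hn => ?_
              rw [Finset.mem_Icc] at hn
              have hn0 : (0 : ℝ) < n := by exact_mod_cast hn.1
              rw [hfdef, show -σ = (1 - σ) + (-1) by ring, Real.rpow_add hn0, Real.rpow_neg_one]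
              gcongr
              exact (Nat.le_floor_iff (by linarith)).1 hn.2
          _ ≤ _ := by
              rw [← Finset.mul_sum]
              gcongr
              exact sum_Icc_inv_le_one_add_log hy

lemma rankinSum_one_le {y : ℝ} {N : ℕ} (hN : 1 ≤ N) : rankinSum 1 y N ≤ 1 + Real.log N := by
  have h := sum_Icc_inv_le_one_add_log (y := N) (by exact_mod_cast hN)
  rw [Nat.floor_natCast] at h
  refine le_trans ?_ h
  rw [rankinSum]
  simp_rw [Real.rpow_neg_one]
  refine Finset.sum_le_sum_of_subset_of_nonneg (fun n hn => ?_) fun _ _ _ => by positivity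
  rw [mem_smoothUpTo] at hn
  exact Finset.mem_Icc.2 ⟨hn.1, hn.2.1⟩

/-- A lower bound for the count of smooth numbers from products of `u` primes. -/
lemma primeCounting_pow_le {y : ℝ} {u N : ℕ} (hy : 0 ≤ y) (hN : y ^ u ≤ N) :
    Nat.primeCounting ⌊y⌋₊ ^ u ≤ u ^ u * (smoothUpTo y N).card := by
  set P := (⌊y⌋₊ + 1).primesBelow with hP
  have hcard : P.card = Nat.primeCounting ⌊y⌋₊ := by
    rw [hP, Nat.primesBelow_card_eq_primeCounting', Nat.primeCounting]
  have hPs : ∀ p ∈ P, p.Prime ∧ (p : ℝ) ≤ y := fun p hp =>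
    ⟨Nat.prime_of_mem_primesBelow hp,
      (Nat.le_floor_iff hy).1 (Nat.le_of_lt_succ (Nat.lt_of_mem_primesBelow hp))⟩
  rw [← hcard, ← Fintype.card_piFinset_const P u]
  refine Finset.card_le_mul_card_image_of_maps_to (f := fun g : Fin u → ℕ => ∏ i, g i) ?_ _ ?_
  · intro g hg
    rw [Fintype.mem_piFinset] at hg
    rw [mem_smoothUpTo]
    refine ⟨Finset.prod_pos fun i _ => (hPs _ (hg i)).1.pos, ?_, ?_⟩
    · have : ((∏ i, g i : ℕ) : ℝ) ≤ y ^ u := by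
        rw [Nat.cast_prod]
        calc ∏ i, ((g i : ℕ) : ℝ) ≤ ∏ _i : Fin u, y :=
              Finset.prod_le_prod (fun _ _ => by positivity) fun i _ => (hPs _ (hg i)).2
          _ = y ^ u := by simp
      exact_mod_cast this.trans hN
    · intro p hp hd
      obtain ⟨i, -, hi⟩ := (Prime.dvd_finsetProd_iff hp.prime _).1 hd
      rw [(Nat.prime_dvd_prime_iff_eq hp (hPs _ (hg i)).1).1 hi]
      exact (hPs _ (hg i)).2
  · intro n hn
    rcases ((Fintype.piFinset fun _ : Fin u => P).filter
      fun g => ∏ i, g i = n).eq_empty_or_nonempty with h | ⟨g₀, hg₀⟩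
    · rw [h]; simp
    rw [Finset.mem_filter, Fintype.mem_piFinset] at hg₀
    calc _ ≤ (Fintype.piFinset fun _ : Fin u => Finset.univ.image g₀).card := by
          refine Finset.card_le_card fun g hg => ?_
          rw [Finset.mem_filter, Fintype.mem_piFinset] at hg
          rw [Fintype.mem_piFinset]
          intro i
          have hp := (hPs _ (hg.1 i)).1
          have hd : g i ∣ ∏ j, g₀ j := by
            rw [hg₀.2, ← hg.2]
            exact Finset.dvd_prod_of_mem _ (Finset.mem_univ i)
          obtain ⟨j, -, hj⟩ := (Prime.dvd_finsetProd_iff hp.prime _).1 hd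
          rw [(Nat.prime_dvd_prime_iff_eq hp (hPs _ (hg₀.1 j)).1).1 hj]
          exact Finset.mem_image_of_mem _ (Finset.mem_univ j)
      _ ≤ u ^ u := by
          rw [Fintype.card_piFinset_const]
          exact Nat.pow_le_pow_left (Finset.card_image_le.trans (by simp)) u

lemma eventually_const_mul_one_add_log_le (C : ℝ) {s : ℝ} (hs : 0 < s) :
    ∀ᶠ t : ℝ in Filter.atTop, C * (1 + Real.log t) ≤ t ^ s := by
  have h1 : (fun t : ℝ => C * (1 + Real.log t)) =o[Filter.atTop] fun t : ℝ => t ^ s := by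
    refine Asymptotics.IsLittleO.const_mul_left (Asymptotics.IsLittleO.add ?_
      (isLittleO_log_rpow_atTop hs)) C
    exact (Asymptotics.isLittleO_const_left.2 (Or.inr
      (tendsto_norm_atTop_atTop.comp (tendsto_rpow_atTop hs))))
  filter_upwards [h1.bound one_pos, Filter.eventually_ge_atTop 0] with t ht ht0
  rw [one_mul, Real.norm_of_nonneg (by positivity : 0 ≤ t ^ s)] at ht
  exact (Real.le_norm_self _).trans ht

lemma eventually_rpow_le_primeCounting {s : ℝ} (hs : 0 < s) :
    ∀ᶠ y : ℝ in Filter.atTop, y ^ (1 - s) ≤ Nat.primeCounting ⌊y⌋₊ := by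
  filter_upwards [eventually_const_mul_one_add_log_le 8 one_pos,
    eventually_const_mul_one_add_log_le 4 hs, Filter.eventually_ge_atTop 8] with y h1 h2 hy
  rw [Real.rpow_one] at h1
  have hy0 : 0 < y := by linarith
  have hlog : 0 < Real.log y := Real.log_pos (by linarith)
  refine le_trans ?_ (Chebyshev.pi_ge' (by linarith))
  rw [le_div_iff₀ hlog]
  have h3 : y ^ (1 - s) * y ^ s = y := by rw [← Real.rpow_add hy0]; simp
  have h4 : y ^ (1 - s) * Real.log y ≤ y / 4 := by
    have : y ^ (1 - s) * (4 * (1 + Real.log y)) ≤ y ^ (1 - s) * y ^ s := by gcongr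
    rw [h3] at this
    have h0 : 0 < y ^ (1 - s) := by positivity
    linarith
  have h5 : Real.log (y + 2) ≤ Real.log 2 + Real.log y := by
    rw [← Real.log_mul two_ne_zero hy0.ne']
    exact Real.log_le_log (by linarith) (by linarith)
  nlinarith [Real.log_two_gt_d9, Real.log_two_lt_d9]

/-- The exponent `σ` used in Rankin's method. -/
def rankinExponent (s y : ℝ) (N : ℕ) : ℝ :=
  min 1 (1 - Real.log (Real.log N) / Real.log y + s)

lemma tendsto_log_natCast_atTop :
    Filter.Tendsto (fun N : ℕ => Real.log N) Filter.atTop Filter.atTop :=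
  Real.tendsto_log_atTop.comp tendsto_natCast_atTop_atTop

lemma log_log_div_log_le {y A : ℝ} {N : ℕ} (hA : 0 < A) (hN : 1 < Real.log N)
    (hy : Real.log N ^ A ≤ y) :
    0 < Real.log (Real.log N) ∧ 0 < Real.log y ∧ 1 < y ∧
      Real.log (Real.log N) / Real.log y ≤ 1 / A := by
  have h1 := Real.log_pos hN
  have h2 : 1 < Real.log N ^ A := Real.one_lt_rpow hN hA
  have h3 : A * Real.log (Real.log N) ≤ Real.log y := by
    rw [← Real.log_rpow (by linarith)]
    exact Real.log_le_log (by linarith) hy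
  have h4 : 0 < Real.log y := lt_of_lt_of_le (by positivity) h3
  refine ⟨h1, h4, h2.trans_le hy, ?_⟩
  rw [div_le_div_iff₀ h4 hA]
  linarith

lemma eventually_forall_of_log_rpow_le {A : ℝ} (hA : 0 < A) {p : ℝ → Prop}
    (hp : ∀ᶠ y in Filter.atTop, p y) :
    ∀ᶠ N : ℕ in Filter.atTop, ∀ y : ℝ, Real.log N ^ A ≤ y → p y := by
  obtain ⟨Y, hY⟩ := Filter.eventually_atTop.1 hp
  filter_upwards [((tendsto_rpow_atTop hA).comp tendsto_log_natCast_atTop).eventually_ge_atTop Y]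
    with N hN y hy
  exact hY y (le_trans hN hy)

lemma eventually_rankinSum_le {s A : ℝ} (hs : 0 < s) (hA : 2 ≤ A) :
    ∀ᶠ N : ℕ in Filter.atTop, ∀ y : ℝ, Real.log N ^ A ≤ y →
      rankinSum (rankinExponent s y N) y N ≤ (N : ℝ) ^ s := by
  have hA0 : 0 < A := by linarith
  filter_upwards [eventually_forall_of_log_rpow_le hA0
    (eventually_const_mul_one_add_log_le (4 / s) hs),
    tendsto_natCast_atTop_atTop.eventually (eventually_const_mul_one_add_log_le 1 hs),
    tendsto_log_natCast_atTop.eventually_gt_atTop 1, Filter.eventually_ge_atTop 1]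
    with N h1 h2 h3 hN y hy
  obtain ⟨hl, hly, hy1, hv⟩ := log_log_div_log_le hA0 h3 hy
  have hv2 : 1 / A ≤ 1 / 2 := one_div_le_one_div_of_le two_pos hA
  have hN0 : (0 : ℝ) < N := by exact_mod_cast hN
  rw [rankinExponent]
  set v := Real.log (Real.log N) / Real.log y with hvdef
  rcases le_total 1 (1 - v + s) with h | h
  · rw [min_eq_left h]
    exact (rankinSum_one_le hN).trans (by linarith)
  · rw [min_eq_right h]
    refine (rankinSum_le_exp N (by linarith) h hy1.le).trans ?_
    have hyv : y ^ v = Real.log N := by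
      rw [hvdef, Real.rpow_def_of_pos (by linarith), mul_div_cancel₀ _ hly.ne',
        Real.exp_log (by linarith)]
    have hy2 : y ^ (1 - (1 - v + s)) * y ^ s = Real.log N := by
      rw [← Real.rpow_add (by linarith), ← hyv]; ring_nf
    rw [Real.rpow_def_of_pos hN0, Real.exp_le_exp]
    have h4 := h1 y hy
    have h5 : 4 * (1 + Real.log y) ≤ s * y ^ s := by
      rw [div_mul_eq_mul_div, div_le_iff₀ hs] at h4
      linarith
    have h6 : 0 < y ^ (1 - (1 - v + s)) := Real.rpow_pos_of_pos (by linarith) _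
    nlinarith [mul_le_mul_of_nonneg_left h5 h6.le]

lemma eventually_le_card_smoothUpTo {s A : ℝ} (hs : 0 < s) (hs4 : s ≤ 1 / 4) (hA : 2 ≤ A) :
    ∀ᶠ N : ℕ in Filter.atTop, ∀ y : ℝ, Real.log N ^ A ≤ y →
      (N : ℝ) ^ (rankinExponent s y N - 2 * s) / y ≤ (smoothUpTo y N).card := by
  have hA0 : 0 < A := by linarith
  filter_upwards [eventually_forall_of_log_rpow_le hA0 (eventually_rpow_le_primeCounting hs),
    eventually_forall_of_log_rpow_le hA0 (Filter.eventually_ge_atTop (Real.exp 1)),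
    tendsto_log_natCast_atTop.eventually_gt_atTop 1, Filter.eventually_ge_atTop 1]
    with N h1 h2 h3 hN y hy
  obtain ⟨hl, hly, hy1, hv⟩ := log_log_div_log_le hA0 h3 hy
  have hv2 : 1 / A ≤ 1 / 2 := one_div_le_one_div_of_le two_pos hA
  have hN0 : (0 : ℝ) < N := by exact_mod_cast hN
  have hy0 : 0 < y := by linarith
  have hL0 : 0 < Real.log N := by linarith
  rw [rankinExponent]
  set v := Real.log (Real.log N) / Real.log y with hvdef
  have hvl : v * Real.log y = Real.log (Real.log N) := div_mul_cancel₀ _ hly.ne'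
  set u := ⌊Real.log N / Real.log y⌋₊ with hu
  have hu1 : (u : ℝ) * Real.log y ≤ Real.log N := by
    rw [← le_div_iff₀ hly]
    exact Nat.floor_le (by positivity)
  have hu2 : Real.log N - Real.log y ≤ u * Real.log y := by
    have := Nat.lt_floor_add_one (Real.log N / Real.log y)
    rw [div_lt_iff₀ hly] at this
    linarith
  have hyu : y ^ u ≤ (N : ℝ) := by
    rw [← Real.log_le_log_iff (by positivity) hN0, Real.log_pow]
    exact hu1
  have huL : (u : ℝ) ≤ Real.log N := by
    refine (Nat.floor_le (by positivity)).trans (div_le_self hL0.le ?_)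
    rw [← Real.log_exp 1]
    exact Real.log_le_log (Real.exp_pos 1) (h2 y hy)
  have hmain : (y ^ (1 - s)) ^ u ≤ Real.log N ^ u * (smoothUpTo y N).card := by
    calc (y ^ (1 - s)) ^ u ≤ (Nat.primeCounting ⌊y⌋₊ : ℝ) ^ u :=
          pow_le_pow_left₀ (by positivity) (h1 y hy) u
      _ ≤ (u : ℝ) ^ u * (smoothUpTo y N).card := by
          exact_mod_cast primeCounting_pow_le hy0.le hyu
      _ ≤ _ := by gcongr
  rw [← mul_comm, ← div_le_iff₀ (by positivity)] at hmain
  refine le_trans ?_ hmain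
  rw [← Real.exp_log (show 0 < (y ^ (1 - s)) ^ u / Real.log N ^ u by positivity),
    ← Real.exp_log (show 0 < (N : ℝ) ^ (min 1 (1 - v + s) - 2 * s) / y by positivity),
    Real.exp_le_exp, Real.log_div (by positivity) hy0.ne', Real.log_rpow hN0,
    Real.log_div (by positivity) (by positivity), Real.log_pow, Real.log_pow, Real.log_rpow hy0,
    ← hvl]
  have hmin := min_le_right 1 (1 - v + s)
  calc (min 1 (1 - v + s) - 2 * s) * Real.log N - Real.log y
      ≤ (1 - v - s) * Real.log N - (1 - v - s) * Real.log y := by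
        have hv0 : 0 < v := by positivity
        nlinarith
    _ = (1 - v - s) * (Real.log N - Real.log y) := by ring
    _ ≤ (1 - v - s) * (u * Real.log y) := by
        gcongr
        linarith
    _ = _ := by ring

/-- The exponential sum over smooth numbers, in terms of a rational approximation `a / q`. -/
lemma norm_sum_e2pi_smooth_le {α B y σ X : ℝ} {a : ℤ} {q D N : ℕ} (hq : 1 ≤ q)
    (hcop : IsCoprime a (q : ℤ)) (hB : |q * α - a| = B) (hBpos : 0 < B) (hqD : 4 * q ≤ D)
    (hDB : 4 * N * B ≤ D) (hDup : (D : ℝ) ≤ 8 * max (q : ℝ) (N * B)) (hDN : (D : ℝ) ^ 2 ≤ 64 * N)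
    (hy : 1 ≤ y) (hσ0 : 0 ≤ σ) (hσ1 : σ ≤ 1) (hDy : D * ⌊y⌋₊ ≤ N) (hL : 1 ≤ Real.log N)
    (hX0 : 0 ≤ X)
    (hX : 320 * Real.log N * q.divisors.card * rankinSum σ y N ^ 3 * y ^ 3 * (N : ℝ) ^ (2 * σ) *
      (D : ℝ) ^ (2 - 3 * σ) ≤ X ^ 2) :
    ‖∑ m ∈ smoothUpTo y N, e2pi (α * m)‖ ≤ D + 2 * y * X := by
  have hy0 : 0 < y := by linarith
  have hD1 : 1 ≤ D := by omega
  have hD0 : (0 : ℝ) < D := by exact_mod_cast hD1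
  have hD1' : (1 : ℝ) ≤ D := by exact_mod_cast hD1
  have hfl1 : 1 ≤ ⌊y⌋₊ := by rwa [Nat.one_le_floor_iff]
  have hDN' : D ≤ N := le_trans (Nat.le_mul_of_pos_right D hfl1) hDy
  have hN0 : (0 : ℝ) < N := hD0.trans_le (by exact_mod_cast hDN')
  have hfl : (⌊y⌋₊ : ℝ) ≤ y := Nat.floor_le hy0.le
  set R := rankinSum σ y N with hR
  have hR0 : 0 ≤ R := rankinSum_nonneg _ _ _
  obtain ⟨A, C, hA1, hA2, hC, hsum⟩ := exists_bilinear_decomposition α (y := y) (N := N) hD1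
  have hbound : ∀ p, ‖∑ d ∈ A p, ∑ k ∈ (C p).filter (fun k => d * k ≤ N),
      e2pi (α * (d * k : ℕ))‖ ≤ X := by
    intro p
    have hY : ((D * ⌊y⌋₊ : ℕ) : ℝ) ≤ y * D := by
      push_cast
      rw [mul_comm]
      gcongr
    have hnear := fun γ : ℝ => card_near_le (γ := γ) hq hcop hB hBpos hqD hDB hDup hDN hy hσ0 hσ1
    have h := sq_norm_bilinear_le (α := α) (N := N) (B := C p) hD1 (hA1 p) hY
      (fun γ => le_trans (by
        exact_mod_cast Finset.card_le_card (Finset.filter_subset_filter _ (hC p))) (hnear γ))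
    refine abs_le_of_sq_le_sq' (h.trans (le_trans ?_ hX)) hX0 |>.2
    have hAc : ((A p).card : ℝ) ≤ (y * (D : ℝ) ^ σ) * R := by
      calc ((A p).card : ℝ) ≤ (smoothUpTo y (D * ⌊y⌋₊)).card := by
            exact_mod_cast Finset.card_le_card (hA2 p)
        _ ≤ (y * D) ^ σ * R := card_smoothUpTo_le hσ0 hDy hY
        _ ≤ _ := by
            rw [Real.mul_rpow hy0.le hD0.le]
            gcongr
            simpa using Real.rpow_le_rpow_of_exponent_le hy hσ1
    have hCc : ((C p).card : ℝ) ≤ ((N : ℝ) ^ σ * (D : ℝ) ^ (-σ)) * R := by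
      calc ((C p).card : ℝ) ≤ (smoothUpTo y (N / D)).card := by
            exact_mod_cast Finset.card_le_card (hC p)
        _ ≤ ((N : ℝ) / D) ^ σ * R := card_smoothUpTo_le hσ0 (Nat.div_le_self _ _) Nat.cast_div_le
        _ = _ := by rw [Real.div_rpow hN0.le hD0.le, Real.rpow_neg hD0.le, div_eq_mul_inv]
    have hlast : 2 * (y * D) + D * (1 + Real.log D) ≤ 4 * Real.log N * y * D := by
      have h1 : Real.log D ≤ Real.log N :=
        Real.log_le_log hD0 (by exact_mod_cast hDN')
      have h2 : 1 + Real.log D ≤ 2 * Real.log N * y := by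
        nlinarith [mul_nonneg (by linarith : 0 ≤ Real.log N) (by linarith : 0 ≤ y - 1)]
      have h3 : 2 * y ≤ 2 * Real.log N * y := by nlinarith
      nlinarith
    have hlog0 : 0 ≤ Real.log D := Real.log_nonneg hD1'
    calc _ ≤ ((y * (D : ℝ) ^ σ) * R) * ((((N : ℝ) ^ σ * (D : ℝ) ^ (-σ)) * R) *
          ((80 * y * q.divisors.card * R * (N : ℝ) ^ σ * (D : ℝ) ^ (1 - 3 * σ)) *
            (4 * Real.log N * y * D))) := by gcongr
      _ = 320 * Real.log N * q.divisors.card * R ^ 3 * y ^ 3 * ((N : ℝ) ^ σ * (N : ℝ) ^ σ) *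
          ((D : ℝ) ^ σ * (D : ℝ) ^ (-σ) * (D : ℝ) ^ (1 - 3 * σ) * (D : ℝ) ^ (1 : ℝ)) := by
          rw [Real.rpow_one]; ring
      _ = _ := by
          rw [← Real.rpow_add hN0, ← Real.rpow_add hD0, ← Real.rpow_add hD0, ← Real.rpow_add hD0]
          ring_nf
  calc _ ≤ _ := hsum
    _ ≤ D + ∑ _p ∈ Finset.range (⌊y⌋₊ + 1), X := by
        gcongr with p
        exact hbound p
    _ ≤ D + 2 * y * X := by
        rw [Finset.sum_const, Finset.card_range, nsmul_eq_mul]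
        push_cast
        gcongr
        linarith

/-- Rational approximations with denominators in a polynomial range, for `α` of finite type. -/
lemma eventually_exists_approximation {α c κ : ℝ} (hc : 0 < c) (hκ : 0 < κ)
    (hα : ∀ m : ℕ, 1 ≤ m → c / (m : ℝ) ^ κ ≤ ‖((α * m : ℝ) : UnitAddCircle)‖) :
    ∀ᶠ N : ℕ in Filter.atTop, ∃ (a : ℤ) (q D : ℕ), 1 ≤ q ∧ q ≤ N ∧ IsCoprime a (q : ℤ) ∧
      0 < |q * α - a| ∧ 4 * q ≤ D ∧ 4 * N * |q * α - a| ≤ D ∧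
      (D : ℝ) ≤ 8 * max (q : ℝ) (N * |q * α - a|) ∧ (D : ℝ) ^ 2 ≤ 64 * N ∧
      (N : ℝ) ^ (1 / (4 * κ)) ≤ D := by
  have hev := ((tendsto_rpow_atTop (show (0 : ℝ) < 1 / 4 by norm_num)).comp
    tendsto_natCast_atTop_atTop).eventually_ge_atTop (1 / c)
  filter_upwards [hev, Filter.eventually_ge_atTop 1] with N h1 hN
  have hN0 : (0 : ℝ) < N := by exact_mod_cast hN
  have hn : 0 < Nat.sqrt N := Nat.sqrt_pos.2 hN
  obtain ⟨r, hr1, hr2⟩ := Real.exists_rat_abs_sub_le_and_den_le α hn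
  set q := r.den with hq
  have hq1 : 1 ≤ q := r.den_pos
  have hq0 : (0 : ℝ) < q := by exact_mod_cast hq1
  set B := |q * α - r.num| with hB
  have hs0 : 0 < √(N : ℝ) := Real.sqrt_pos.2 hN0
  have hss : √(N : ℝ) * √(N : ℝ) = N := Real.mul_self_sqrt hN0.le
  have hns : √(N : ℝ) ≤ (Nat.sqrt N : ℝ) + 1 := Real.real_sqrt_le_nat_sqrt_succ
  have hqs : (q : ℝ) ≤ √(N : ℝ) := le_trans (by exact_mod_cast hr2) Real.nat_sqrt_le_real_sqrt
  have hBle : B ≤ 1 / √(N : ℝ) := by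
    have h2 : (q : ℝ) * α - r.num = q * (α - r) := by
      rw [mul_sub]
      congr 1
      exact_mod_cast (Rat.den_mul_eq_num r).symm
    rw [hB, h2, abs_mul, abs_of_pos hq0]
    calc (q : ℝ) * |α - r| ≤ q * (1 / ((Nat.sqrt N + 1) * q)) := by gcongr
      _ = 1 / (Nat.sqrt N + 1) := by field_simp
      _ ≤ _ := one_div_le_one_div_of_le hs0 hns
  have hBlow : c / (q : ℝ) ^ κ ≤ B := by
    refine (hα q hq1).trans ?_
    have h2 : ((α * q : ℝ) : UnitAddCircle) = ((q * α - r.num : ℝ) : UnitAddCircle) := by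
      rw [AddCircle.coe_sub, coe_intCast_eq_zero, sub_zero, mul_comm]
    rw [h2]
    exact QuotientAddGroup.norm_mk_le_norm
  have hB0 : 0 < B := lt_of_lt_of_le (by positivity) hBlow
  have hNB : N * B ≤ √(N : ℝ) := by
    calc N * B ≤ N * (1 / √(N : ℝ)) := by gcongr
      _ = √(N : ℝ) := by
        rw [mul_one_div, div_eq_iff hs0.ne', hss]
  set M := max (q : ℝ) (N * B) with hM
  have hMs : M ≤ √(N : ℝ) := max_le hqs hNB
  have hM1 : 1 ≤ M := le_trans (by exact_mod_cast hq1) (le_max_left _ _)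
  have hDlow : 4 * M ≤ (⌈4 * M⌉₊ : ℝ) := Nat.le_ceil _
  have hDup : (⌈4 * M⌉₊ : ℝ) ≤ 8 * M := by
    have := Nat.ceil_lt_add_one (show 0 ≤ 4 * M by linarith)
    linarith
  have hqM : (q : ℝ) ≤ M := le_max_left _ _
  refine ⟨r.num, q, ⌈4 * M⌉₊, hq1, hr2.trans (Nat.sqrt_le_self N), ?_, hB0, ?_, ?_, hDup, ?_, ?_⟩
  · rw [Int.isCoprime_iff_nat_coprime]
    simpa using r.reduced
  · have : (4 : ℝ) * q ≤ ⌈4 * M⌉₊ := by linarith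
    exact_mod_cast this
  · have : N * B ≤ M := le_max_right _ _
    linarith
  · calc (⌈4 * M⌉₊ : ℝ) ^ (2 : ℕ) ≤ (8 * √(N : ℝ)) ^ (2 : ℕ) := by gcongr; linarith
      _ = 64 * (N : ℝ) := by rw [mul_pow, Real.sq_sqrt hN0.le]; norm_num
  · refine le_trans ?_ (show (q : ℝ) ≤ _ by linarith)
    have h2 : c * √(N : ℝ) ≤ (q : ℝ) ^ κ := by
      have := hBlow.trans hBle
      rw [div_le_div_iff₀ (by positivity) hs0] at this
      linarith
    have h3 : (N : ℝ) ^ (1 / 4 : ℝ) ≤ (q : ℝ) ^ κ := by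
      refine le_trans ?_ h2
      have h4 : √(N : ℝ) = (N : ℝ) ^ (1 / 4 : ℝ) * (N : ℝ) ^ (1 / 4 : ℝ) := by
        rw [← Real.rpow_add hN0, Real.sqrt_eq_rpow]; norm_num
      have h5 : 1 ≤ c * (N : ℝ) ^ (1 / 4 : ℝ) := by
        have h1' : 1 / c ≤ (N : ℝ) ^ (1 / 4 : ℝ) := h1
        rwa [div_le_iff₀ hc, mul_comm] at h1'
      rw [h4, ← mul_assoc]
      exact le_mul_of_one_le_left (by positivity) h5
    calc (N : ℝ) ^ (1 / (4 * κ)) = ((N : ℝ) ^ (1 / 4 : ℝ)) ^ (1 / κ) := by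
          rw [← Real.rpow_mul hN0.le]; congr 1; field_simp
      _ ≤ ((q : ℝ) ^ κ) ^ (1 / κ) := Real.rpow_le_rpow (by positivity) h3 (by positivity)
      _ = q := by rw [← Real.rpow_mul hq0.le, mul_one_div_cancel hκ.ne', Real.rpow_one]

/-- Power saving for exponential sums over `y`-smooth numbers when `y` is a small power of `N`. -/
lemma exists_norm_sum_e2pi_le_of_le_rpow {α c κ ε : ℝ} (hc : 0 < c) (hκ : 0 < κ) (hε : 0 < ε)
    (hα : ∀ m : ℕ, 1 ≤ m → c / (m : ℝ) ^ κ ≤ ‖((α * m : ℝ) : UnitAddCircle)‖) :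
    ∃ s : ℝ, 0 < s ∧ ∀ᶠ N : ℕ in Filter.atTop, ∀ y : ℝ, Real.log N ^ (3 + ε) ≤ y →
      y ≤ (N : ℝ) ^ s →
      ‖∑ m ∈ smoothUpTo y N, e2pi (α * m)‖ ≤ (N : ℝ) ^ (-s) * (smoothUpTo y N).card := by
  set η₀ : ℝ := min (1 / 4) (1 / (4 * κ)) with hη₀
  have hη₀0 : 0 < η₀ := by positivity
  have hη₀4 : η₀ ≤ 1 / 4 := min_le_left _ _
  set ρ : ℝ := 1 / 3 - 1 / (3 + ε) with hρ
  have hρ0 : 0 < ρ := by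
    rw [hρ, sub_pos]
    exact one_div_lt_one_div_of_lt (by norm_num) (by linarith)
  have hρ3 : ρ ≤ 1 / 3 := by
    have : 0 < 1 / (3 + ε) := by positivity
    linarith
  set s : ℝ := ρ * η₀ / 20 with hs
  have hs0 : 0 < s := by positivity
  have hs1 : s ≤ 1 / 240 := by
    have : ρ * η₀ ≤ 1 / 3 * (1 / 4) := by gcongr
    rw [hs]; linarith
  refine ⟨s, hs0, ?_⟩
  obtain ⟨Cτ, hCτ0, hCτ⟩ := exists_card_divisors_le (half_pos hs0)
  have hpow : ∀ {t : ℝ}, 0 < t → ∀ K : ℝ, ∀ᶠ N : ℕ in Filter.atTop, K ≤ (N : ℝ) ^ t :=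
    fun ht K => ((tendsto_rpow_atTop ht).comp
      tendsto_natCast_atTop_atTop).eventually_ge_atTop K
  filter_upwards [eventually_exists_approximation hc hκ hα,
    eventually_rankinSum_le hs0 (show (2 : ℝ) ≤ 3 + ε by linarith),
    eventually_le_card_smoothUpTo hs0 (by linarith) (show (2 : ℝ) ≤ 3 + ε by linarith),
    hpow hs0 4, hpow (half_pos hs0) Cτ,
    tendsto_natCast_atTop_atTop.eventually (eventually_const_mul_one_add_log_le 320 hs0),
    tendsto_log_natCast_atTop.eventually_gt_atTop 1, Filter.eventually_ge_atTop 1]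
    with N happ hR hΨ h4 hτN hlog hL hN y hy hyN
  obtain ⟨a, q, D, hq, hqN, hcop, hBpos, hqD, hDB, hDup, hDN, hDlow⟩ := happ
  have hN0 : (0 : ℝ) < N := by exact_mod_cast hN
  have hN1 : (1 : ℝ) ≤ N := by exact_mod_cast hN
  obtain ⟨hl, hly, hy1, hv⟩ := log_log_div_log_le (by linarith) hL hy
  have hy0 : 0 < y := by linarith
  have hD1' : (1 : ℝ) ≤ D := by exact_mod_cast (show 1 ≤ D by omega)
  have hD0 : (0 : ℝ) < D := by linarith
  specialize hR y hy
  specialize hΨ y hy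
  set σ := rankinExponent s y N with hσ
  have hσ1 : σ ≤ 1 := min_le_left _ _
  have hσ2 : 2 / 3 + ρ ≤ σ := by
    rw [hσ, rankinExponent]
    refine le_min (by linarith) ?_
    rw [hρ]
    linarith
  have hDhalf : (D : ℝ) ≤ 8 * (N : ℝ) ^ (1 / 2 : ℝ) := by
    rw [← Real.sqrt_eq_rpow]
    refine abs_le_of_sq_le_sq' ?_ (by positivity) |>.2
    rw [mul_pow, Real.sq_sqrt hN0.le]
    linarith
  have hmono : ∀ {t t' : ℝ}, t ≤ t' → (N : ℝ) ^ t ≤ (N : ℝ) ^ t' := fun h =>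
    Real.rpow_le_rpow_of_exponent_le hN1 h
  have h16 : 16 ≤ (N : ℝ) ^ (2 * s) := by
    rw [two_mul, Real.rpow_add hN0]
    nlinarith
  have hDy : D * ⌊y⌋₊ ≤ N := by
    have h1 : (D : ℝ) * ⌊y⌋₊ ≤ N := by
      calc (D : ℝ) * ⌊y⌋₊ ≤ ((N : ℝ) ^ (2 * s) * (N : ℝ) ^ (1 / 2 : ℝ)) * (N : ℝ) ^ s := by
            gcongr
            · refine hDhalf.trans ?_
              gcongr
              linarith
            · exact (Nat.floor_le hy0.le).trans hyN
        _ = (N : ℝ) ^ (2 * s + 1 / 2 + s) := by rw [← Real.rpow_add hN0, ← Real.rpow_add hN0]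
        _ ≤ (N : ℝ) ^ (1 : ℝ) := hmono (by linarith)
        _ = N := Real.rpow_one _
    exact_mod_cast h1
  have hτ : (q.divisors.card : ℝ) ≤ (N : ℝ) ^ s := by
    calc (q.divisors.card : ℝ) ≤ Cτ * (q : ℝ) ^ (s / 2) := hCτ q hq
      _ ≤ (N : ℝ) ^ (s / 2) * (N : ℝ) ^ (s / 2) := by gcongr
      _ = (N : ℝ) ^ s := by rw [← Real.rpow_add hN0]; ring_nf
  have hDpow : (D : ℝ) ^ (2 - 3 * σ) ≤ (N : ℝ) ^ (-60 * s) := by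
    calc (D : ℝ) ^ (2 - 3 * σ) ≤ (D : ℝ) ^ (-(3 * ρ)) :=
          Real.rpow_le_rpow_of_exponent_le hD1' (by linarith)
      _ ≤ ((N : ℝ) ^ η₀) ^ (-(3 * ρ)) := by
          refine Real.rpow_le_rpow_of_nonpos (by positivity) ?_ (by linarith)
          exact (hmono (min_le_right _ _)).trans hDlow
      _ = (N : ℝ) ^ (-60 * s) := by
          rw [← Real.rpow_mul hN0.le, hs]; congr 1; ring
  have hlog' : 320 * Real.log N ≤ (N : ℝ) ^ s := by linarith
  have hX : 320 * Real.log N * q.divisors.card * rankinSum σ y N ^ 3 * y ^ 3 * (N : ℝ) ^ (2 * σ) *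
      (D : ℝ) ^ (2 - 3 * σ) ≤ ((N : ℝ) ^ (σ - 26 * s)) ^ 2 := by
    have hR0 := rankinSum_nonneg σ y N
    have hL0 : 0 ≤ Real.log N := by linarith
    calc _ ≤ (N : ℝ) ^ s * (N : ℝ) ^ s * ((N : ℝ) ^ s) ^ 3 * ((N : ℝ) ^ s) ^ 3 *
          (N : ℝ) ^ (2 * σ) * (N : ℝ) ^ (-60 * s) := by gcongr
      _ = _ := by
        simp only [← Real.rpow_natCast, ← Real.rpow_mul hN0.le, ← Real.rpow_add hN0]
        congr 1
        push_cast
        ring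
  have hmain := norm_sum_e2pi_smooth_le hq hcop rfl hBpos hqD hDB hDup hDN hy1.le (by linarith)
    hσ1 hDy hL.le (by positivity) hX
  have hcard : (N : ℝ) ^ (σ - 3 * s) ≤ (smoothUpTo y N).card := by
    refine le_trans ?_ hΨ
    rw [le_div_iff₀ hy0]
    calc (N : ℝ) ^ (σ - 3 * s) * y ≤ (N : ℝ) ^ (σ - 3 * s) * (N : ℝ) ^ s := by gcongr
      _ = (N : ℝ) ^ (σ - 2 * s) := by rw [← Real.rpow_add hN0]; ring_nf
  refine hmain.trans ?_
  calc (D : ℝ) + 2 * y * (N : ℝ) ^ (σ - 26 * s)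
      ≤ 8 * (N : ℝ) ^ (1 / 2 : ℝ) + 2 * (N : ℝ) ^ s * (N : ℝ) ^ (σ - 26 * s) := by gcongr
    _ ≤ (N : ℝ) ^ (2 * s) / 2 * (N : ℝ) ^ (1 / 2 : ℝ) +
          (N : ℝ) ^ (2 * s) / 2 * (N : ℝ) ^ s * (N : ℝ) ^ (σ - 26 * s) := by
        gcongr <;> linarith
    _ = (N : ℝ) ^ (2 * s + 1 / 2) / 2 + (N : ℝ) ^ (2 * s + s + (σ - 26 * s)) / 2 := by
        rw [Real.rpow_add hN0 (2 * s), Real.rpow_add hN0 (2 * s + s), Real.rpow_add hN0 (2 * s)]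
        ring
    _ ≤ (N : ℝ) ^ (-s + (σ - 3 * s)) / 2 + (N : ℝ) ^ (-s + (σ - 3 * s)) / 2 := by
        have h1 := hmono (show 2 * s + 1 / 2 ≤ -s + (σ - 3 * s) by linarith)
        have h2 := hmono (show 2 * s + s + (σ - 26 * s) ≤ -s + (σ - 3 * s) by linarith)
        linarith
    _ = (N : ℝ) ^ (-s) * (N : ℝ) ^ (σ - 3 * s) := by rw [Real.rpow_add hN0]; ring
    _ ≤ _ := by gcongr

/-! ### Exponential sums over smooth numbers, large `y` -/

lemma card_filter_dvd_Icc (N d : ℕ) :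
    ((Finset.Icc 1 N).filter fun n => d ∣ n).card = N / d := by
  rw [← Nat.Ioc_filter_dvd_card_eq_div]
  rfl

lemma sum_omega_sub_sq_le {P : Finset ℕ} (hP : ∀ p ∈ P, p.Prime) (N : ℕ) :
    ∑ n ∈ Finset.Icc 1 N, (((P.filter (· ∣ n)).card : ℝ) - ∑ p ∈ P, (p : ℝ)⁻¹) ^ 2 ≤
      N * (∑ p ∈ P, (p : ℝ)⁻¹) + 2 * (∑ p ∈ P, (p : ℝ)⁻¹) * P.card := by
  set L := ∑ p ∈ P, (p : ℝ)⁻¹ with hL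
  have hL0 : 0 ≤ L := Finset.sum_nonneg fun _ _ => by positivity
  have hω : ∀ n : ℕ, ((P.filter (· ∣ n)).card : ℝ) = ∑ p ∈ P, if p ∣ n then (1 : ℝ) else 0 :=
    fun n => by rw [Finset.card_filter]; push_cast; rfl
  have hdiv : ∀ d : ℕ, ∑ n ∈ Finset.Icc 1 N, (if d ∣ n then (1 : ℝ) else 0) = (N / d : ℕ) := by
    intro d
    rw [← card_filter_dvd_Icc, Finset.card_filter]
    push_cast
    rfl
  have h1 : ∑ n ∈ Finset.Icc 1 N, ((P.filter (· ∣ n)).card : ℝ) = ∑ p ∈ P, ((N / p : ℕ) : ℝ) := by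
    simp_rw [hω]
    rw [Finset.sum_comm]
    exact Finset.sum_congr rfl fun p _ => hdiv p
  have h1' : N * L - P.card ≤ ∑ n ∈ Finset.Icc 1 N, ((P.filter (· ∣ n)).card : ℝ) := by
    rw [h1, hL, Finset.mul_sum, Finset.cast_card, ← Finset.sum_sub_distrib]
    refine Finset.sum_le_sum fun p hp => ?_
    have := Nat.lt_floor_add_one ((N : ℝ) / p)
    rw [Nat.floor_div_eq_div] at this
    rw [← div_eq_mul_inv]
    linarith
  have h2 : ∑ n ∈ Finset.Icc 1 N, ((P.filter (· ∣ n)).card : ℝ) ^ 2 ≤ N * L ^ 2 + N * L := by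
    have : ∀ n ∈ Finset.Icc 1 N, ((P.filter (· ∣ n)).card : ℝ) ^ 2 =
        ∑ p ∈ P, ∑ q ∈ P, if p ∣ n ∧ q ∣ n then (1 : ℝ) else 0 := by
      intro n _
      rw [sq, hω, Finset.sum_mul_sum]
      refine Finset.sum_congr rfl fun p _ => Finset.sum_congr rfl fun q _ => ?_
      split_ifs <;> simp_all
    rw [Finset.sum_congr rfl this, Finset.sum_comm]
    calc _ ≤ ∑ p ∈ P, (N * ((p : ℝ)⁻¹ * L) + N * (p : ℝ)⁻¹) := by
          refine Finset.sum_le_sum fun p hp => ?_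
          rw [Finset.sum_comm]
          calc _ ≤ ∑ q ∈ P, (N * ((p : ℝ)⁻¹ * (q : ℝ)⁻¹) + if q = p then N * (p : ℝ)⁻¹ else 0) := by
                refine Finset.sum_le_sum fun q hq => ?_
                have hp0 : (0 : ℝ) < p := by exact_mod_cast (hP p hp).pos
                have hq0 : (0 : ℝ) < q := by exact_mod_cast (hP q hq).pos
                split_ifs with hqp
                · subst hqp
                  simp only [and_self]
                  rw [hdiv]
                  have h0 : (0 : ℝ) ≤ N * ((q : ℝ)⁻¹ * (q : ℝ)⁻¹) := by positivity
                  have hle := Nat.cast_div_le (α := ℝ) (m := N) (n := q)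
                  rw [div_eq_mul_inv] at hle
                  linarith
                · have hcop : Nat.Coprime p q :=
                    (Nat.coprime_primes (hP p hp) (hP q hq)).2 (Ne.symm hqp)
                  have hiff : ∀ n, (p ∣ n ∧ q ∣ n) ↔ p * q ∣ n := fun n =>
                    ⟨fun h => hcop.mul_dvd_of_dvd_of_dvd h.1 h.2,
                      fun h => ⟨dvd_of_mul_right_dvd h, dvd_of_mul_left_dvd h⟩⟩
                  simp_rw [hiff]
                  rw [hdiv, add_zero, ← mul_inv, ← div_eq_mul_inv]
                  exact_mod_cast Nat.cast_div_le (α := ℝ) (m := N) (n := p * q)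
            _ = _ := by
                rw [Finset.sum_add_distrib, Finset.sum_ite_eq' P p, if_pos hp, ← Finset.mul_sum,
                  ← Finset.mul_sum]
      _ = N * L ^ 2 + N * L := by
          rw [Finset.sum_add_distrib, ← Finset.mul_sum, ← Finset.mul_sum, ← Finset.sum_mul]
          ring
  calc _ = ∑ n ∈ Finset.Icc 1 N, ((P.filter (· ∣ n)).card : ℝ) ^ 2 -
        2 * L * ∑ n ∈ Finset.Icc 1 N, ((P.filter (· ∣ n)).card : ℝ) + N * L ^ 2 := by
        simp_rw [sub_sq, Finset.sum_add_distrib, Finset.sum_sub_distrib]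
        rw [Finset.sum_const, Nat.card_Icc, nsmul_eq_mul, Finset.mul_sum]
        congr 1
        congr 1
        exact Finset.sum_congr rfl fun _ _ => by ring
    _ ≤ _ := by nlinarith

lemma sum_sq_norm_sum_primes_le {α : ℝ} (hα : Irrational α) {P : Finset ℕ}
    (hP : ∀ p ∈ P, p.Prime) : ∃ C : ℝ, 0 ≤ C ∧ ∀ N : ℕ,
      ∑ m ∈ Finset.Ioc 0 N, ‖∑ p ∈ P.filter (fun p => p * m ≤ N), e2pi (α * (p * m : ℕ))‖ ^ 2 ≤
        N * (∑ p ∈ P, (p : ℝ)⁻¹) + C := by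
  set K : ℕ → ℕ → ℝ := fun p q =>
    if p = q then 0 else 1 / (2 * ‖((α * q - α * p : ℝ) : UnitAddCircle)‖) with hK
  have hK0 : ∀ p q, 0 ≤ K p q := fun p q => by simp only [hK]; positivity
  refine ⟨∑ p ∈ P, ∑ q ∈ P, K p q,
    Finset.sum_nonneg fun p _ => Finset.sum_nonneg fun q _ => hK0 p q, fun N => ?_⟩
  set g : ℕ → ℂ := fun m => ∑ p ∈ P.filter (fun p => p * m ≤ N), e2pi (α * (p * m : ℕ)) with hg
  have hexp : ∀ m, ((‖g m‖ ^ 2 : ℝ) : ℂ) = ∑ k ∈ P, ∑ l ∈ P,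
      if k * m ≤ N ∧ l * m ≤ N then e2pi (m * (α * l - α * k)) else 0 := by
    intro d
    rw [← Complex.normSq_eq_norm_sq, ← Complex.mul_conj, mul_comm, hg]
    simp only [map_sum, Finset.sum_mul_sum, Finset.sum_filter]
    refine Finset.sum_congr rfl fun k _ => ?_
    split_ifs with hk
    · refine Finset.sum_congr rfl fun l _ => ?_
      by_cases hl : l * d ≤ N
      · rw [if_pos hl, if_pos ⟨hk, hl⟩, conj_e2pi, ← e2pi_add]
        push_cast; ring_nf
      · rw [if_neg hl, if_neg (fun h => hl h.2), mul_zero]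
    · simp [hk]
  have h2 : ((∑ m ∈ Finset.Ioc 0 N, ‖g m‖ ^ 2 : ℝ) : ℂ) = ∑ k ∈ P, ∑ l ∈ P,
      ∑ m ∈ (Finset.Ioc 0 N).filter (fun m => k * m ≤ N ∧ l * m ≤ N),
        e2pi (m * (α * l - α * k)) := by
    push_cast
    simp_rw [← Complex.ofReal_pow, hexp, Finset.sum_filter]
    rw [Finset.sum_comm]
    exact Finset.sum_congr rfl fun k _ => Finset.sum_comm
  have h0 : 0 ≤ ∑ m ∈ Finset.Ioc 0 N, ‖g m‖ ^ 2 := Finset.sum_nonneg fun _ _ => by positivity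
  rw [← abs_of_nonneg h0, ← Real.norm_eq_abs, ← Complex.norm_real, h2, Finset.mul_sum,
    ← Finset.sum_add_distrib]
  refine (norm_sum_le _ _).trans (Finset.sum_le_sum fun k hk => ?_)
  refine (norm_sum_le _ _).trans ?_
  have hsplit : (N : ℝ) * (k : ℝ)⁻¹ = ∑ l ∈ P, if k = l then (N : ℝ) * (k : ℝ)⁻¹ else 0 := by
    rw [Finset.sum_ite_eq, if_pos hk]
  rw [hsplit, ← Finset.sum_add_distrib]
  refine Finset.sum_le_sum fun l hl => ?_
  have hset : (Finset.Ioc 0 N).filter (fun m => k * m ≤ N ∧ l * m ≤ N) =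
      Finset.Ioc 0 (N / max k l) := by
    have hm : 0 < max k l := lt_max_of_lt_left (hP k hk).pos
    ext d
    simp only [Finset.mem_filter, Finset.mem_Ioc, Nat.le_div_iff_mul_le hm]
    have : d * max k l = max (k * d) (l * d) := by
      rw [mul_comm k, mul_comm l]; exact Nat.mul_max_mul_left d k l |>.symm
    rw [this, max_le_iff]
    constructor
    · rintro ⟨⟨h1, -⟩, h3⟩; exact ⟨h1, h3⟩
    · rintro ⟨h1, h3⟩
      exact ⟨⟨h1, le_trans (Nat.le_mul_of_pos_left d (hP k hk).pos) h3.1⟩, h3⟩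
  rw [hset]
  by_cases hkl : k = l
  · subst hkl
    simp only [hK, if_pos, add_zero, max_self, sub_self, mul_zero]
    refine (norm_sum_e2pi_mul_le_card _ fun _ => 0).trans ?_
    rw [Nat.card_Ioc, Nat.sub_zero, ← div_eq_mul_inv]
    exact Nat.cast_div_le
  · simp only [hK, if_neg hkl, zero_add]
    have hne : ((α * l - α * k : ℝ) : UnitAddCircle) ≠ 0 := by
      intro h
      obtain ⟨n, hn⟩ := (AddCircle.coe_eq_zero_iff 1).1 h
      have hlk : (l : ℤ) - k ≠ 0 := by omega
      refine (hα.mul_intCast hlk).ne_int n ?_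
      push_cast
      rw [mul_sub, ← hn]
      simp
    have hpos : 0 < 2 * ‖((α * l - α * k : ℝ) : UnitAddCircle)‖ := by positivity
    rw [le_div_iff₀ hpos]
    exact norm_sum_e2pi_mul_le _ _ _

lemma exists_primes_sum_inv_ge (K : ℝ) :
    ∃ P : Finset ℕ, (∀ p ∈ P, p.Prime) ∧ K ≤ ∑ p ∈ P, (p : ℝ)⁻¹ := by
  by_contra! h
  refine Nat.Primes.not_summable_one_div (summable_of_sum_le (c := K) (fun _ => by positivity) ?_)
  intro u
  have := h (u.map ⟨fun p : Nat.Primes => (p : ℕ), Subtype.val_injective⟩) (by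
    intro p hp
    obtain ⟨q, -, rfl⟩ := Finset.mem_map.1 hp
    exact q.2)
  rw [Finset.sum_map] at this
  simp only [one_div]
  exact this.le

/-- The Daboussi-Kátai argument: exponential sums over smooth numbers are `o(N)`. -/
lemma exists_norm_sum_e2pi_le_mul {α δ : ℝ} (hα : Irrational α) (hδ : 0 < δ) :
    ∃ Y : ℝ, ∀ᶠ N : ℕ in Filter.atTop, ∀ y : ℝ, Y ≤ y →
      ‖∑ m ∈ smoothUpTo y N, e2pi (α * m)‖ ≤ δ * N := by
  obtain ⟨P, hP, hPL⟩ := exists_primes_sum_inv_ge (max 1 (32 / δ ^ 2))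
  obtain ⟨C, hC0, hC⟩ := sum_sq_norm_sum_primes_le hα hP
  have hV := sum_omega_sub_sq_le hP
  set L := ∑ p ∈ P, (p : ℝ)⁻¹ with hL
  have hL1 : 1 ≤ L := (le_max_left _ _).trans hPL
  have hLδ : 32 ≤ L * δ ^ 2 := by
    have := (le_max_right _ _).trans hPL
    rwa [div_le_iff₀ (by positivity)] at this
  refine ⟨∑ p ∈ P, (p : ℝ), ?_⟩
  filter_upwards [tendsto_natCast_atTop_atTop.eventually_ge_atTop (2 * P.card + C)] with N hN y hy
  set S := smoothUpTo y N with hS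
  have hPy : ∀ p ∈ P, (p : ℝ) ≤ y := fun p hp => le_trans
    (Finset.single_le_sum (f := fun p : ℕ => (p : ℝ)) (fun _ _ => by positivity) hp) hy
  have hSsub : S ⊆ Finset.Icc 1 N := fun n hn => by
    rw [hS, mem_smoothUpTo] at hn
    exact Finset.mem_Icc.2 ⟨hn.1, hn.2.1⟩
  have hdecomp : (L : ℂ) * ∑ m ∈ S, e2pi (α * m) =
      (∑ n ∈ S, ((P.filter (· ∣ n)).card : ℂ) * e2pi (α * n)) -
        ∑ n ∈ S, ((((P.filter (· ∣ n)).card : ℝ) - L : ℝ) : ℂ) * e2pi (α * n) := by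
    rw [← Finset.sum_sub_distrib, Finset.mul_sum]
    exact Finset.sum_congr rfl fun n _ => by push_cast; ring
  have hswap : ∑ n ∈ S, ((P.filter (· ∣ n)).card : ℂ) * e2pi (α * n) =
      ∑ m ∈ S, ∑ p ∈ P.filter (fun p => p * m ≤ N), e2pi (α * (p * m : ℕ)) := by
    have h1 : ∀ n : ℕ, ((P.filter (· ∣ n)).card : ℂ) * e2pi (α * n) =
        ∑ p ∈ P, if p ∣ n then e2pi (α * n) else 0 := fun n => by
      rw [← Finset.sum_filter, Finset.sum_const, nsmul_eq_mul]
    simp_rw [h1, Finset.sum_filter]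
    rw [Finset.sum_comm, Finset.sum_comm (s := S)]
    refine Finset.sum_congr rfl fun p hp => ?_
    rw [← Finset.sum_filter, ← Finset.sum_filter]
    symm
    refine Finset.sum_bij (fun m _ => p * m) ?_ ?_ ?_ ?_
    · intro m hm
      rw [Finset.mem_filter, hS, mem_smoothUpTo] at hm
      rw [Finset.mem_filter, hS, mem_smoothUpTo]
      exact ⟨⟨Nat.mul_pos (hP p hp).pos hm.1.1, hm.2,
        (isSmooth_prime (hP p hp) (hPy p hp)).mul hm.1.2.2⟩, dvd_mul_right _ _⟩
    · intro m _ m' _ h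
      exact Nat.eq_of_mul_eq_mul_left (hP p hp).pos h
    · intro n hn
      rw [Finset.mem_filter, hS, mem_smoothUpTo] at hn
      obtain ⟨⟨hn1, hnN, hns⟩, m, rfl⟩ := hn
      have hm1 : 1 ≤ m := Nat.pos_of_ne_zero fun h => by simp [h] at hn1
      refine ⟨m, ?_, rfl⟩
      rw [Finset.mem_filter, hS, mem_smoothUpTo]
      exact ⟨⟨hm1, le_trans (Nat.le_mul_of_pos_left m (hP p hp).pos) hnN,
        hns.of_dvd (dvd_mul_left _ _)⟩, hnN⟩
    · intro m _; rfl
  have hNn : (0 : ℝ) ≤ N := Nat.cast_nonneg N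
  have hbd : ∀ (f : ℕ → ℝ), (∀ n, 0 ≤ f n) → ∑ n ∈ Finset.Icc 1 N, f n ^ 2 ≤ 2 * (N * L) →
      ∑ n ∈ S, f n ≤ L * δ * N / 2 := by
    intro f hf hf2
    refine le_trans (Finset.sum_le_sum_of_subset_of_nonneg hSsub fun n _ _ => hf n) ?_
    refine abs_le_of_sq_le_sq' ?_ (by positivity) |>.2
    calc _ ≤ ((Finset.Icc 1 N).card : ℝ) * ∑ n ∈ Finset.Icc 1 N, f n ^ 2 :=
          sq_sum_le_card_mul_sum_sq
      _ ≤ N * (2 * (N * L)) := by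
          rw [Nat.card_Icc, Nat.add_sub_cancel]
          gcongr
      _ ≤ _ := by
          have : 32 * (N ^ 2 * L) ≤ (L * δ ^ 2) * (N ^ 2 * L) := by gcongr
          nlinarith [mul_nonneg (sq_nonneg (N : ℝ)) (by linarith : 0 ≤ L)]
  have hA : ‖∑ m ∈ S, ∑ p ∈ P.filter (fun p => p * m ≤ N), e2pi (α * (p * m : ℕ))‖ ≤
      L * δ * N / 2 := by
    refine (norm_sum_le _ _).trans (hbd _ (fun _ => norm_nonneg _) ((hC N).trans ?_))
    nlinarith [Nat.cast_nonneg (α := ℝ) P.card]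
  have hB : ‖∑ n ∈ S, ((((P.filter (· ∣ n)).card : ℝ) - L : ℝ) : ℂ) * e2pi (α * n)‖ ≤
      L * δ * N / 2 := by
    refine (norm_sum_le _ _).trans ?_
    simp_rw [norm_mul, norm_e2pi, mul_one, Complex.norm_real, Real.norm_eq_abs]
    refine hbd _ (fun _ => abs_nonneg _) ?_
    simp_rw [sq_abs]
    refine (hV N).trans ?_
    nlinarith [Nat.cast_nonneg (α := ℝ) P.card]
  have hfin : L * ‖∑ m ∈ S, e2pi (α * m)‖ ≤ L * (δ * N) := by
    have : ‖(L : ℂ) * ∑ m ∈ S, e2pi (α * m)‖ = L * ‖∑ m ∈ S, e2pi (α * m)‖ := by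
      rw [norm_mul, Complex.norm_real, Real.norm_of_nonneg (by linarith)]
    rw [← this, hdecomp, hswap]
    refine (norm_sub_le _ _).trans ?_
    linarith
  exact le_of_mul_le_mul_left hfin (by linarith)

lemma exists_theta_sub_ge :
    ∃ T₀ : ℕ, 1 ≤ T₀ ∧ ∀ t : ℕ, T₀ ≤ t →
      (t : ℝ) ≤ Chebyshev.theta (4 * t : ℕ) - Chebyshev.theta t := by
  have h := eventually_const_mul_one_add_log_le 60 (s := 1 / 2) (by norm_num)
  have htend : Filter.Tendsto (fun t : ℕ => ((4 * t : ℕ) : ℝ) + 1) Filter.atTop Filter.atTop :=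
    Filter.tendsto_atTop_add_const_right _ _
      (tendsto_natCast_atTop_atTop.comp (Filter.tendsto_id.const_mul_atTop' (by norm_num)))
  obtain ⟨T₀, hT⟩ := Filter.eventually_atTop.1 (htend.eventually h)
  refine ⟨max 1 T₀, le_max_left _ _, fun t ht => ?_⟩
  have ht1 : (1 : ℝ) ≤ t := by exact_mod_cast (le_max_left _ _).trans ht
  have h1 := hT t ((le_max_right _ _).trans ht)
  have h2 := Chebyshev.theta_ge (4 * t)
  have h3 := Chebyshev.theta_le_log4_mul_x (x := (t : ℝ)) (by positivity)
  have h4 : Real.log 4 = 2 * Real.log 2 := by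
    rw [show (4 : ℝ) = 2 ^ 2 by norm_num, Real.log_pow]; norm_num
  rw [h4] at h3
  rw [← Real.sqrt_eq_rpow] at h1
  push_cast at h1 h2 ⊢
  set u : ℝ := 4 * t + 1 with hu
  have hlog : 0 ≤ Real.log u := Real.log_nonneg (by linarith)
  have hsq : √(4 * (t : ℝ)) ≤ √u := Real.sqrt_le_sqrt (by linarith)
  have hlog' : Real.log (4 * t) ≤ Real.log u := Real.log_le_log (by linarith) (by linarith)
  have hlog0 : 0 ≤ Real.log (4 * t) := Real.log_nonneg (by linarith)
  have h5 : √(4 * (t : ℝ)) * Real.log (4 * t) ≤ √u * Real.log u := by gcongr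
  have hsu : √u * √u = u := Real.mul_self_sqrt (by linarith)
  have hs1 : 1 ≤ √u := Real.one_le_sqrt.2 (by linarith)
  have h6 : √u * Real.log u ≤ u / 60 := by nlinarith
  have h7 : Real.log u ≤ √u * Real.log u := by nlinarith
  have := Real.log_two_gt_d9
  nlinarith

lemma exists_sum_log_div_Ioc_ge :
    ∃ T₀ : ℕ, 1 ≤ T₀ ∧ ∀ t : ℕ, T₀ ≤ t → ∀ i : ℕ,
      (i : ℝ) / 4 ≤ ∑ p ∈ (Finset.Ioc t (4 ^ i * t)).filter Nat.Prime, Real.log p / p := by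
  obtain ⟨T₀, hT1, hT⟩ := exists_theta_sub_ge
  refine ⟨T₀, hT1, fun t ht i => ?_⟩
  induction i with
  | zero => simp
  | succ i ih =>
    set s := 4 ^ i * t with hs
    have hts : t ≤ s := Nat.le_mul_of_pos_left _ (by positivity)
    have hs0 : (0 : ℝ) < s := by exact_mod_cast (by omega : 0 < s)
    have hs4 : 4 ^ (i + 1) * t = 4 * s := by rw [hs]; ring
    have hdisj : Disjoint ((Finset.Ioc t s).filter Nat.Prime)
        ((Finset.Ioc s (4 * s)).filter Nat.Prime) :=
      Finset.disjoint_filter_filter (Finset.Ioc_disjoint_Ioc_of_le le_rfl)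
    have hunion : (Finset.Ioc t (4 * s)).filter Nat.Prime =
        (Finset.Ioc t s).filter Nat.Prime ∪ (Finset.Ioc s (4 * s)).filter Nat.Prime := by
      rw [← Finset.filter_union, Finset.Ioc_union_Ioc_eq_Ioc hts (by omega)]
    rw [hs4, hunion, Finset.sum_union hdisj]
    have hblock : (1 : ℝ) / 4 ≤
        ∑ p ∈ (Finset.Ioc s (4 * s)).filter Nat.Prime, Real.log p / p := by
      have h := hT s (ht.trans hts)
      have hθ : Chebyshev.theta (4 * s : ℕ) - Chebyshev.theta s =
          ∑ p ∈ (Finset.Ioc s (4 * s)).filter Nat.Prime, Real.log p := by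
        rw [Chebyshev.theta, Chebyshev.theta, Nat.floor_natCast, Nat.floor_natCast,
          ← Finset.Ioc_union_Ioc_eq_Ioc (Nat.zero_le s) (by omega : s ≤ 4 * s),
          Finset.filter_union, Finset.sum_union
            (Finset.disjoint_filter_filter (Finset.Ioc_disjoint_Ioc_of_le le_rfl))]
        ring
      rw [hθ] at h
      calc (1 : ℝ) / 4 = s / (4 * s) := by field_simp
        _ ≤ (∑ p ∈ (Finset.Ioc s (4 * s)).filter Nat.Prime, Real.log p) / (4 * s) := by gcongr
        _ ≤ _ := by
          rw [Finset.sum_div]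
          refine Finset.sum_le_sum fun p hp => ?_
          obtain ⟨hp1, hp2⟩ := Finset.mem_filter.1 hp
          have hp4 : (p : ℝ) ≤ 4 * s := by exact_mod_cast (Finset.mem_Ioc.1 hp1).2
          have hp0 : (1 : ℝ) ≤ p := by exact_mod_cast hp2.one_le
          have := Real.log_nonneg hp0
          gcongr
    push_cast
    linarith

lemma eventually_log_div_le_sum :
    ∀ᶠ y : ℝ in Filter.atTop, Real.log y / 16 ≤
      ∑ p ∈ (Finset.Ioc ⌈√y⌉₊ ⌊y⌋₊).filter Nat.Prime, Real.log p / p := by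
  obtain ⟨T₀, hT1, hT⟩ := exists_sum_log_div_Ioc_ge
  filter_upwards [Filter.eventually_ge_atTop 4, Filter.eventually_ge_atTop ((T₀ : ℝ) ^ 2),
    Real.tendsto_log_atTop.eventually_ge_atTop 60] with y hy4 hyT hlog
  have hy0 : (0 : ℝ) ≤ y := by linarith
  set T := ⌈√y⌉₊ with hTdef
  have hTT : T₀ ≤ T := by
    have : (T₀ : ℝ) ≤ √y := Real.le_sqrt_of_sq_le hyT
    exact_mod_cast this.trans (Nat.le_ceil _)
  have hs2 : 2 ≤ √y := Real.le_sqrt_of_sq_le (by linarith)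
  have hT2 : (T : ℝ) ≤ 2 * √y := by
    have := Nat.ceil_lt_add_one (Real.sqrt_nonneg y)
    linarith
  have hT0 : (0 : ℝ) < T := lt_of_lt_of_le (by linarith) (Nat.le_ceil (√y))
  have hlogT : Real.log T ≤ Real.log 2 + Real.log y / 2 := by
    rw [← Real.log_sqrt hy0, ← Real.log_mul (by norm_num) (by positivity)]
    exact Real.log_le_log hT0 hT2
  have h4 : Real.log 4 = 2 * Real.log 2 := by
    rw [show (4 : ℝ) = 2 ^ 2 by norm_num, Real.log_pow]; norm_num
  have hl2 := Real.log_two_lt_d9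
  have hl2' := Real.log_two_gt_d9
  set i := ⌊(Real.log y - Real.log T) / Real.log 4⌋₊ with hi
  have hnn : 0 ≤ (Real.log y - Real.log T) / Real.log 4 :=
    div_nonneg (by linarith) (by linarith)
  have hi1 : (i : ℝ) * Real.log 4 ≤ Real.log y - Real.log T := by
    rw [← le_div_iff₀ (by linarith)]
    exact Nat.floor_le hnn
  have hi2 : Real.log y - Real.log T ≤ (i + 1) * Real.log 4 := by
    rw [← div_le_iff₀ (by linarith)]
    exact (Nat.lt_floor_add_one _).le
  have hle : 4 ^ i * T ≤ ⌊y⌋₊ := by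
    refine Nat.le_floor ?_
    push_cast
    rw [← Real.log_le_log_iff (by positivity) (by linarith), Real.log_mul (by positivity) hT0.ne',
      Real.log_pow]
    linarith
  calc Real.log y / 16 ≤ (i : ℝ) / 4 := by nlinarith
    _ ≤ _ := hT T hTT i
    _ ≤ _ := by
      refine Finset.sum_le_sum_of_subset_of_nonneg
        (Finset.filter_subset_filter _ (Finset.Ioc_subset_Ioc_right hle)) fun p hp _ => ?_
      have hp0 : (1 : ℝ) ≤ p := by exact_mod_cast (Finset.mem_filter.1 hp).2.one_le
      have := Real.log_nonneg hp0
      positivity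

lemma sum_log_mul_card_le {y : ℝ} {P : Finset ℕ} (hP : ∀ p ∈ P, p.Prime ∧ (p : ℝ) ≤ y) (N : ℕ) :
    ∑ p ∈ P, Real.log p * (smoothUpTo y (N / p)).card ≤
      (smoothUpTo y N).card * Real.log N := by
  have h1 : ∀ p ∈ P, (smoothUpTo y (N / p)).card ≤ ((smoothUpTo y N).filter (p ∣ ·)).card := by
    intro p hp
    have hp0 := (hP p hp).1.pos
    refine Finset.card_le_card_of_injOn (p * ·) ?_ fun a _ b _ h => Nat.eq_of_mul_eq_mul_left hp0 h
    intro k hk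
    obtain ⟨hk1, hk2, hk3⟩ := mem_smoothUpTo.1 (Finset.mem_coe.1 hk)
    refine Finset.mem_coe.2 (Finset.mem_filter.2 ⟨mem_smoothUpTo.2 ⟨?_, ?_, ?_⟩, dvd_mul_right _ _⟩)
    · exact Nat.mul_pos hp0 hk1
    · exact (Nat.mul_le_mul_left p hk2).trans (Nat.mul_div_le N p)
    · exact (isSmooth_prime (hP p hp).1 (hP p hp).2).mul hk3
  calc ∑ p ∈ P, Real.log p * (smoothUpTo y (N / p)).card
      ≤ ∑ p ∈ P, ∑ m ∈ smoothUpTo y N, if p ∣ m then Real.log p else 0 := by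
        refine Finset.sum_le_sum fun p hp => ?_
        rw [← Finset.sum_filter, Finset.sum_const, nsmul_eq_mul, mul_comm]
        have : 0 ≤ Real.log p := Real.log_natCast_nonneg p
        have := h1 p hp
        gcongr
    _ = ∑ m ∈ smoothUpTo y N, ∑ p ∈ P, if p ∣ m then Real.log p else 0 := Finset.sum_comm
    _ ≤ ∑ m ∈ smoothUpTo y N, Real.log N := by
        refine Finset.sum_le_sum fun m hm => ?_
        obtain ⟨hm1, hm2, -⟩ := mem_smoothUpTo.1 hm
        calc _ = ∑ p ∈ P.filter (· ∣ m), ArithmeticFunction.vonMangoldt p := by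
              rw [← Finset.sum_filter]
              refine Finset.sum_congr rfl fun p hp => ?_
              rw [ArithmeticFunction.vonMangoldt_apply_prime (hP p (Finset.mem_filter.1 hp).1).1]
          _ ≤ ∑ d ∈ m.divisors, ArithmeticFunction.vonMangoldt d := by
              refine Finset.sum_le_sum_of_subset_of_nonneg (fun p hp => ?_)
                fun _ _ _ => ArithmeticFunction.vonMangoldt_nonneg
              exact Nat.mem_divisors.2 ⟨(Finset.mem_filter.1 hp).2, by omega⟩
          _ = Real.log m := ArithmeticFunction.vonMangoldt_sum
          _ ≤ Real.log N := Real.log_le_log (by exact_mod_cast hm1) (by exact_mod_cast hm2)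
    _ = _ := by rw [Finset.sum_const, nsmul_eq_mul]

lemma card_smoothUpTo_of_le {y : ℝ} {N : ℕ} (h : (N : ℝ) ≤ y) : (smoothUpTo y N).card = N := by
  have : smoothUpTo y N = Finset.Icc 1 N := by
    ext n
    rw [mem_smoothUpTo, Finset.mem_Icc]
    refine ⟨fun h => ⟨h.1, h.2.1⟩, fun hn => ⟨hn.1, hn.2, isSmooth_of_le (by omega) ?_⟩⟩
    exact le_trans (by exact_mod_cast hn.2) h
  rw [this, Nat.card_Icc, Nat.add_sub_cancel]

lemma exists_mul_le_card_smoothUpTo (j : ℕ) :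
    ∃ C : ℝ, 0 < C ∧ ∀ᶠ y : ℝ in Filter.atTop, ∀ X : ℝ, 1 ≤ X → X ≤ y ^ (1 + (j : ℝ) / 2) →
      C * X ≤ (smoothUpTo y ⌊X⌋₊).card := by
  have hsmall : ∀ y X : ℝ, 1 ≤ X → X ≤ y → 1 / 2 * X ≤ (smoothUpTo y ⌊X⌋₊).card := by
    intro y X hX hXy
    have h1 : (1 : ℝ) ≤ ⌊X⌋₊ := by exact_mod_cast Nat.one_le_floor_iff _ |>.2 hX
    rw [card_smoothUpTo_of_le ((Nat.floor_le (by linarith)).trans hXy)]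
    linarith [Nat.lt_floor_add_one X]
  induction j with
  | zero =>
    refine ⟨1 / 2, by norm_num, Filter.Eventually.of_forall fun y X hX hXy => hsmall y X hX ?_⟩
    simpa using hXy
  | succ j ih =>
    obtain ⟨C, hC, h⟩ := ih
    set D : ℝ := 1 + ((j + 1 : ℕ) : ℝ) / 2 with hD
    have hD0 : 0 < D := by positivity
    refine ⟨min (1 / 2) (C / (16 * D)), by positivity, ?_⟩
    filter_upwards [h, eventually_log_div_le_sum, Filter.eventually_gt_atTop 1] with
      y hy hsum hy1 X hX hXy
    rcases le_or_gt X y with hle | hlt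
    · refine le_trans ?_ (hsmall y X hX hle)
      gcongr
      exact min_le_left _ _
    set P := (Finset.Ioc ⌈√y⌉₊ ⌊y⌋₊).filter Nat.Prime with hPdef
    have hmem : ∀ p ∈ P, p.Prime ∧ √y ≤ p ∧ (p : ℝ) ≤ y := by
      intro p hp
      obtain ⟨hp1, hp2⟩ := Finset.mem_filter.1 hp
      obtain ⟨h1, h2⟩ := Finset.mem_Ioc.1 hp1
      refine ⟨hp2, Nat.ceil_le.1 h1.le, ?_⟩
      exact (Nat.le_floor_iff (by linarith)).1 h2
    have hlogy : 0 < Real.log y := Real.log_pos hy1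
    have key := sum_log_mul_card_le (fun p hp => ⟨(hmem p hp).1, (hmem p hp).2.2⟩) ⌊X⌋₊
    have hlogX : Real.log ⌊X⌋₊ ≤ D * Real.log y := by
      rw [← Real.log_rpow (by linarith)]
      have h1 : (1 : ℝ) ≤ ⌊X⌋₊ := by exact_mod_cast Nat.one_le_floor_iff _ |>.2 hX
      exact Real.log_le_log (by linarith) ((Nat.floor_le (by linarith)).trans hXy)
    have hlow : C * X * (Real.log y / 16) ≤
        ∑ p ∈ P, Real.log p * (smoothUpTo y (⌊X⌋₊ / p)).card := by
      calc C * X * (Real.log y / 16) ≤ C * X * ∑ p ∈ P, Real.log p / p := by gcongr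
        _ ≤ _ := by
          rw [Finset.mul_sum]
          refine Finset.sum_le_sum fun p hp => ?_
          obtain ⟨hp1, hp2, hp3⟩ := hmem p hp
          have hp0 : (0 : ℝ) < p := by exact_mod_cast hp1.pos
          have hXp : X / p ≤ y ^ (1 + (j : ℝ) / 2) := by
            rw [div_le_iff₀ hp0]
            calc X ≤ y ^ D := hXy
              _ = y ^ (1 + (j : ℝ) / 2) * √y := by
                rw [Real.sqrt_eq_rpow, ← Real.rpow_add (by linarith), hD]
                congr 1; push_cast; ring
              _ ≤ _ := by gcongr
          have := hy (X / p) ((one_le_div hp0).2 (by linarith)) hXp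
          rw [Nat.floor_div_natCast] at this
          have hl := Real.log_natCast_nonneg p
          calc C * X * (Real.log p / p) = Real.log p * (C * (X / p)) := by ring
            _ ≤ _ := by gcongr
    have h2 : C * X * (Real.log y / 16) ≤ (smoothUpTo y ⌊X⌋₊).card * (D * Real.log y) :=
      (hlow.trans key).trans (by gcongr)
    have h3 : C / (16 * D) * X ≤ (smoothUpTo y ⌊X⌋₊).card := by
      rw [div_mul_eq_mul_div, div_le_iff₀ (by positivity)]
      have : C * X * Real.log y ≤ (smoothUpTo y ⌊X⌋₊).card * (16 * D) * Real.log y := by linarith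
      exact le_of_mul_le_mul_right this hlogy
    refine le_trans ?_ h3
    gcongr
    exact min_le_right _ _

/-- Smooth numbers have positive lower density when `y` is at least a fixed power of `N`. -/
lemma exists_mul_le_card_smoothUpTo_of_rpow_le {s : ℝ} (hs : 0 < s) :
    ∃ C : ℝ, 0 < C ∧ ∀ᶠ N : ℕ in Filter.atTop, ∀ y : ℝ, (N : ℝ) ^ s ≤ y →
      C * N ≤ (smoothUpTo y N).card := by
  obtain ⟨j, hj⟩ := exists_nat_ge (2 / s)
  obtain ⟨C, hC, h⟩ := exists_mul_le_card_smoothUpTo j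
  obtain ⟨Y, hY⟩ := Filter.eventually_atTop.1 h
  refine ⟨C, hC, ?_⟩
  have htend := (tendsto_rpow_atTop hs).comp (tendsto_natCast_atTop_atTop (R := ℝ))
  filter_upwards [htend.eventually_ge_atTop Y, Filter.eventually_ge_atTop 1] with N hN hN1 y hy
  have hN1' : (1 : ℝ) ≤ N := by exact_mod_cast hN1
  have := hY y (le_trans hN hy) N hN1' ?_
  · rwa [Nat.floor_natCast] at this
  calc (N : ℝ) = ((N : ℝ) ^ s) ^ s⁻¹ := by
        rw [← Real.rpow_mul (by linarith), mul_inv_cancel₀ hs.ne', Real.rpow_one]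
    _ ≤ y ^ s⁻¹ := by gcongr
    _ ≤ y ^ (1 + (j : ℝ) / 2) := by
        refine Real.rpow_le_rpow_of_exponent_le ((Real.one_le_rpow hN1' hs.le).trans hy) ?_
        rw [div_eq_mul_inv] at hj
        linarith

open MeasureTheory in
lemma tendsto_probabilityMeasure_of_fourier {ι : Type*} {l : Filter ι}
    {μs : ι → ProbabilityMeasure UnitAddCircle} {μ : ProbabilityMeasure UnitAddCircle}
    (h : ∀ k : ℤ, Filter.Tendsto (fun i => ∫ z, fourier k z ∂(μs i : Measure UnitAddCircle)) l
      (nhds (∫ z, fourier k z ∂(μ : Measure UnitAddCircle)))) :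
    Filter.Tendsto μs l (nhds μ) := by
  have hint : ∀ (ν : ProbabilityMeasure UnitAddCircle) (g : C(UnitAddCircle, ℂ)),
      Integrable g (ν : Measure UnitAddCircle) := fun ν g =>
    (BoundedContinuousFunction.mkOfCompact g).integrable _
  have hspan : ∀ g ∈ Submodule.span ℂ (Set.range (@fourier 1)),
      Filter.Tendsto (fun i => ∫ z, g z ∂(μs i : Measure UnitAddCircle)) l
        (nhds (∫ z, g z ∂(μ : Measure UnitAddCircle))) := by
    intro g hg
    induction hg using Submodule.span_induction with
    | mem g hg =>
      obtain ⟨k, rfl⟩ := hg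
      exact h k
    | zero => simpa using tendsto_const_nhds
    | add f g _ _ hf hg =>
      simp only [ContinuousMap.add_apply]
      simp_rw [fun ν : ProbabilityMeasure UnitAddCircle => integral_add (hint ν f) (hint ν g)]
      exact hf.add hg
    | smul a f _ hf =>
      simp only [ContinuousMap.smul_apply, integral_smul]
      exact hf.const_smul a
  rw [ProbabilityMeasure.tendsto_iff_forall_integral_rclike_tendsto ℂ]
  intro f
  have hf : f.toContinuousMap ∈ closure
      (Submodule.span ℂ (Set.range (@fourier 1)) : Set C(UnitAddCircle, ℂ)) := by
    rw [← Submodule.topologicalClosure_coe, span_fourier_closure_eq_top]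
    trivial
  rw [Metric.tendsto_nhds]
  intro ε hε
  obtain ⟨g, hg, hfg⟩ := Metric.mem_closure_iff.1 hf (ε / 3) (by positivity)
  have hclose : ∀ ν : ProbabilityMeasure UnitAddCircle,
      dist (∫ z, f z ∂(ν : Measure UnitAddCircle)) (∫ z, g z ∂(ν : Measure UnitAddCircle)) ≤
        ε / 3 := by
    intro ν
    rw [dist_eq_norm, ← integral_sub (f.integrable _) (hint ν g)]
    refine (norm_integral_le_of_norm_le_const (C := ε / 3)
      (Filter.Eventually.of_forall fun z => ?_)).trans (by simp)
    rw [← dist_eq_norm]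
    exact (ContinuousMap.dist_apply_le_dist (f := f.toContinuousMap) (g := g) z).trans hfg.le
  filter_upwards [Metric.tendsto_nhds.1 (hspan g hg) (ε / 3) (by positivity)] with i hi
  have h1 := hclose (μs i)
  have h2 := hclose μ
  rw [dist_comm] at h2
  calc _ ≤ _ := dist_triangle4 _ _ _ _
    _ < ε := by linarith

open MeasureTheory in
/-- Weyl's criterion for finite sets of points on the circle. -/
lemma tendsto_card_filter_div_of_fourier {ι : Type*} {l : Filter ι} {S : ι → Finset ℕ}
    (hS : ∀ i, (S i).Nonempty) {g : ℕ → UnitAddCircle}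
    (h : ∀ k : ℤ, k ≠ 0 →
      Filter.Tendsto (fun i => ((S i).card : ℂ)⁻¹ * ∑ m ∈ S i, fourier k (g m)) l (nhds 0))
    {A : Set UnitAddCircle} (hA0 : volume (frontier A) = 0) :
    Filter.Tendsto (fun i => (((S i).filter (g · ∈ A)).card : ℝ) / (S i).card) l
      (nhds (volume A).toReal) := by
  have hc : ∀ i, ((S i).card : ENNReal) ≠ 0 := fun i => by simpa using (hS i).ne_empty
  let μs : ι → ProbabilityMeasure UnitAddCircle := fun i =>
    ⟨((S i).card : ENNReal)⁻¹ • ∑ m ∈ S i, Measure.dirac (g m),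
      ⟨by simp [ENNReal.inv_mul_cancel (hc i) (ENNReal.natCast_ne_top _)]⟩⟩
  let μ : ProbabilityMeasure UnitAddCircle := ⟨volume, ⟨by simp⟩⟩
  have key : Filter.Tendsto μs l (nhds μ) := by
    refine tendsto_probabilityMeasure_of_fourier fun k => ?_
    have hL : ∀ i, ∫ z, fourier k z ∂(μs i : Measure UnitAddCircle) =
        ((S i).card : ℂ)⁻¹ * ∑ m ∈ S i, fourier k (g m) := by
      intro i
      change ∫ z, fourier k z ∂(((S i).card : ENNReal)⁻¹ • ∑ m ∈ S i, Measure.dirac (g m)) = _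
      have hsum := integral_finsetSum_measure (s := S i) (μ := fun m => Measure.dirac (g m))
        (f := fun z : UnitAddCircle => fourier k z)
        fun m _ => (BoundedContinuousFunction.mkOfCompact (fourier k)).integrable _
      rw [integral_smul_measure, hsum]
      simp
    simp_rw [hL]
    change Filter.Tendsto _ _ (nhds (∫ z : UnitAddCircle, fourier k z))
    rcases eq_or_ne k 0 with rfl | hk
    · simp only [fourier_zero, Finset.sum_const, nsmul_eq_mul, mul_one]
      have : ∀ i, ((S i).card : ℂ)⁻¹ * (S i).card = 1 := fun i =>
        inv_mul_cancel₀ (by exact_mod_cast (hS i).card_ne_zero)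
      simpa [this, Measure.real] using tendsto_const_nhds
    · rw [integral_eq_zero_of_add_right_eq_neg (fourier_add_half_inv_index hk one_pos)]
      exact h k hk
  have h2 := ProbabilityMeasure.tendsto_measure_of_null_frontier_of_tendsto' key hA0
  have h3 := (ENNReal.tendsto_toReal (measure_ne_top volume A)).comp h2
  refine h3.congr fun i => ?_
  change ((((S i).card : ENNReal)⁻¹ • ∑ m ∈ S i, Measure.dirac (g m)) A).toReal = _
  rw [Measure.smul_apply, Measure.finsetSum_apply]
  simp only [Measure.dirac_apply, Set.indicator_apply, Pi.one_apply, smul_eq_mul]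
  rw [← Finset.sum_filter, Finset.sum_const]
  simp [div_eq_inv_mul]

/-- The exponential sum bound, uniform in the whole range of `y`. -/
lemma eventually_norm_sum_e2pi_le {α c κ ε δ : ℝ} (hc : 0 < c) (hκ : 0 < κ) (hε : 0 < ε)
    (hδ : 0 < δ) (hirr : Irrational α)
    (hα : ∀ m : ℕ, 1 ≤ m → c / (m : ℝ) ^ κ ≤ ‖((α * m : ℝ) : UnitAddCircle)‖) :
    ∀ᶠ N : ℕ in Filter.atTop, ∀ y : ℝ, Real.log N ^ (3 + ε) ≤ y →
      ‖∑ m ∈ smoothUpTo y N, e2pi (α * m)‖ ≤ δ * (smoothUpTo y N).card := by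
  obtain ⟨s, hs, h⟩ := exists_norm_sum_e2pi_le_of_le_rpow hc hκ hε hα
  obtain ⟨C, hC, hlow⟩ := exists_mul_le_card_smoothUpTo_of_rpow_le hs
  obtain ⟨Y, hY⟩ := exists_norm_sum_e2pi_le_mul hirr (mul_pos hδ hC)
  have htend := (tendsto_rpow_atTop hs).comp (tendsto_natCast_atTop_atTop (R := ℝ))
  have htend' := (tendsto_rpow_neg_atTop hs).comp (tendsto_natCast_atTop_atTop (R := ℝ))
  filter_upwards [h, hlow, hY, htend.eventually_ge_atTop Y, htend'.eventually_le_const hδ] with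
    N h1 h2 h3 h4 h5 y hy
  rcases le_total y ((N : ℝ) ^ s) with hle | hge
  · refine (h1 y hy hle).trans ?_
    gcongr
    exact h5
  · calc _ ≤ δ * C * N := h3 y (le_trans h4 hge)
      _ = δ * (C * N) := by ring
      _ ≤ _ := by gcongr; exact h2 y hge

lemma exists_div_rpow_le_norm_intCast_div_mul {θ c κ : ℝ} (hθ : 1 < θ) (hc : 0 < c) (hκ : 0 < κ)
    (hft : ∀ m : ℕ, 0 < m → c / (m : ℝ) ^ κ ≤ |(m : ℝ) * θ - round ((m : ℝ) * θ)|)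
    {k : ℤ} (hk : k ≠ 0) :
    ∃ c' > 0, ∀ m : ℕ, 1 ≤ m → c' / (m : ℝ) ^ κ ≤ ‖((k / θ * m : ℝ) : UnitAddCircle)‖ := by
  have hk1 : (1 : ℝ) ≤ |(k : ℝ)| := by exact_mod_cast Int.one_le_abs hk
  have hθ0 : 0 < θ := by linarith
  refine ⟨min (1 / θ) (c / (θ * (2 * |(k : ℝ)|) ^ κ)), by positivity, fun m hm => ?_⟩
  have hm1 : (1 : ℝ) ≤ m := by exact_mod_cast hm
  have hmκ : 1 ≤ (m : ℝ) ^ κ := Real.one_le_rpow hm1 hκ.le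
  rw [UnitAddCircle.norm_eq]
  set x : ℝ := k / θ * m with hx
  have hxabs : |x| = |(k : ℝ)| * m / θ := by
    rw [hx, abs_mul, abs_div, abs_of_pos hθ0, Nat.abs_cast]; ring
  rcases eq_or_ne (round x) 0 with hr | hr
  · rw [hr, Int.cast_zero, sub_zero, hxabs]
    calc _ ≤ 1 / θ / (m : ℝ) ^ κ := by gcongr; exact min_le_left _ _
      _ ≤ 1 / θ := div_le_self (by positivity) hmκ
      _ ≤ _ := by gcongr; nlinarith
  · set n := (round x).natAbs with hn
    have hn0 : 0 < n := Int.natAbs_pos.2 hr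
    have hncast : (n : ℝ) = |(round x : ℝ)| := by rw [hn, Nat.cast_natAbs, Int.cast_abs]
    have hnear : c / (n : ℝ) ^ κ ≤ θ * |x - round x| := by
      refine (hft n hn0).trans ?_
      have hθx : θ * x = k * m := by rw [hx]; field_simp
      have habs : θ * |x - round x| = |(round x : ℝ) * θ - (k * m : ℤ)| := by
        rw [abs_sub_comm, ← abs_of_pos hθ0, ← abs_mul, abs_of_pos hθ0]
        push_cast
        rw [← hθx]
        ring_nf
      rw [habs]
      rcases abs_choice (round x : ℝ) with h | h
      · rw [hncast, h]
        exact round_le _ _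
      · rw [hncast, h]
        refine (round_le _ (-(k * m : ℤ))).trans (le_of_eq ?_)
        rw [← abs_neg]
        push_cast
        ring_nf
    have hnle : (n : ℝ) ≤ 2 * |(k : ℝ)| * m := by
      have h1 : |(round x : ℝ)| ≤ |x| + 1 := by
        have h2 := abs_sub_round x
        have h3 := abs_sub_abs_le_abs_sub (round x : ℝ) x
        rw [abs_sub_comm] at h3
        linarith
      have h2 : |x| ≤ |(k : ℝ)| * m := by
        rw [hxabs]; exact div_le_self (by positivity) hθ.le
      rw [hncast]
      nlinarith
    have hn0' : (0 : ℝ) < n := by exact_mod_cast hn0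
    calc _ ≤ c / (θ * (2 * |(k : ℝ)|) ^ κ) / (m : ℝ) ^ κ := by gcongr; exact min_le_right _ _
      _ = c / (2 * |(k : ℝ)| * m) ^ κ / θ := by
        rw [Real.mul_rpow (x := 2 * |(k : ℝ)|) (by positivity) (by positivity)]
        simp only [div_div]
        congr 1
        ring
      _ ≤ c / (n : ℝ) ^ κ / θ := by gcongr
      _ ≤ _ := by rw [div_le_iff₀ hθ0, mul_comm _ θ]; exact hnear

lemma fourier_coe_eq_e2pi (k : ℤ) (t : ℝ) : fourier k (t : UnitAddCircle) = e2pi (k * t) := by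
  rw [fourier_coe_apply, e2pi]
  push_cast
  congr 1
  ring

/-- The arc of the circle whose preimage under `m ↦ m / θ` is the Beatty sequence of `θ`, `ψ`. -/
def beattyArc (θ ψ : ℝ) : Set UnitAddCircle :=
  (fun t : ℝ => (t : UnitAddCircle)) '' Set.Ioc ((ψ - 1) / θ) (ψ / θ)

lemma coe_mem_beattyArc {θ ψ : ℝ} (hθ : 0 < θ) (m : ℝ) :
    ((m / θ : ℝ) : UnitAddCircle) ∈ beattyArc θ ψ ↔
      ∃ n : ℤ, m ≤ θ * n + ψ ∧ θ * n + ψ < m + 1 := by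
  have hiff : ∀ n : ℤ, m / θ - n ∈ Set.Ioc ((ψ - 1) / θ) (ψ / θ) ↔
      m ≤ θ * n + ψ ∧ θ * n + ψ < m + 1 := by
    intro n
    have : m / θ - n = (m - θ * n) / θ := by field_simp
    rw [this, Set.mem_Ioc, div_lt_div_iff_of_pos_right hθ, div_le_div_iff_of_pos_right hθ]
    constructor <;> rintro ⟨h1, h2⟩ <;> constructor <;> linarith
  constructor
  · rintro ⟨t, ht, hteq⟩
    have h0 : ((m / θ - t : ℝ) : UnitAddCircle) = 0 := by
      rw [AddCircle.coe_sub, ← hteq, sub_self]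
    obtain ⟨n, hn⟩ := (AddCircle.coe_eq_zero_iff 1).1 h0
    rw [zsmul_one] at hn
    refine ⟨n, (hiff n).1 ?_⟩
    rwa [hn, sub_sub_cancel]
  · rintro ⟨n, hn⟩
    refine ⟨m / θ - n, (hiff n).2 hn, ?_⟩
    simp only [AddCircle.coe_sub, coe_intCast_eq_zero, sub_zero]

lemma ball_subset_beattyArc {θ ψ : ℝ} (hθ : 0 < θ) :
    Metric.ball (((ψ - 1 / 2) / θ : ℝ) : UnitAddCircle) (1 / (2 * θ)) ⊆ beattyArc θ ψ := by
  intro z hz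
  induction z using QuotientAddGroup.induction_on with
  | H t =>
    rw [Metric.mem_ball, dist_eq_norm] at hz
    change ‖(((t - (ψ - 1 / 2) / θ : ℝ)) : UnitAddCircle)‖ < _ at hz
    rw [UnitAddCircle.norm_eq, abs_lt] at hz
    set r := round (t - (ψ - 1 / 2) / θ)
    have h1 : ψ / θ = (ψ - 1 / 2) / θ + 1 / (2 * θ) := by field_simp; ring
    have h2 : (ψ - 1) / θ = (ψ - 1 / 2) / θ - 1 / (2 * θ) := by field_simp; ring
    refine ⟨t - r, ⟨by linarith [hz.1], by linarith [hz.2]⟩, ?_⟩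
    simp only [AddCircle.coe_sub, coe_intCast_eq_zero, sub_zero]

lemma beattyArc_subset_closedBall {θ ψ : ℝ} (hθ : 0 < θ) :
    beattyArc θ ψ ⊆ Metric.closedBall (((ψ - 1 / 2) / θ : ℝ) : UnitAddCircle) (1 / (2 * θ)) := by
  rintro _ ⟨t, ⟨ht1, ht2⟩, rfl⟩
  rw [Metric.mem_closedBall, dist_eq_norm, ← AddCircle.coe_sub, UnitAddCircle.norm_eq]
  refine (round_le _ 0).trans ?_
  have h1 : ψ / θ = (ψ - 1 / 2) / θ + 1 / (2 * θ) := by field_simp; ring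
  have h2 : (ψ - 1) / θ = (ψ - 1 / 2) / θ - 1 / (2 * θ) := by field_simp; ring
  rw [Int.cast_zero, sub_zero, abs_le]
  constructor <;> linarith

open MeasureTheory in
lemma volume_beattyArc {θ ψ : ℝ} (hθ : 1 < θ) :
    (volume (beattyArc θ ψ)).toReal = 1 / θ := by
  have hθ0 : 0 < θ := by linarith
  have hcl : volume (Metric.closedBall (((ψ - 1 / 2) / θ : ℝ) : UnitAddCircle) (1 / (2 * θ))) =
      ENNReal.ofReal (1 / θ) := by
    rw [AddCircle.volume_closedBall, min_eq_right]
    · congr 1; field_simp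
    · rw [show 2 * (1 / (2 * θ)) = 1 / θ by field_simp, div_le_one hθ0]; exact hθ.le
  have hball := measure_congr (AddCircle.closedBall_ae_eq_ball
    (x := (((ψ - 1 / 2) / θ : ℝ) : UnitAddCircle)) (ε := 1 / (2 * θ)))
  have : volume (beattyArc θ ψ) = ENNReal.ofReal (1 / θ) := by
    refine le_antisymm ?_ ?_
    · rw [← hcl]; exact measure_mono (beattyArc_subset_closedBall hθ0)
    · rw [← hcl, hball]; exact measure_mono (ball_subset_beattyArc hθ0)
  rw [this, ENNReal.toReal_ofReal (by positivity)]

open MeasureTheory in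
lemma volume_frontier_beattyArc {θ ψ : ℝ} (hθ : 0 < θ) :
    volume (frontier (beattyArc θ ψ)) = 0 := by
  refine measure_mono_null (t := Metric.closedBall (((ψ - 1 / 2) / θ : ℝ) : UnitAddCircle)
    (1 / (2 * θ)) \ Metric.ball (((ψ - 1 / 2) / θ : ℝ) : UnitAddCircle) (1 / (2 * θ))) ?_
    (ae_le_set.1 AddCircle.closedBall_ae_eq_ball.le)
  exact Set.sdiff_subset_sdiff
    (closure_minimal (beattyArc_subset_closedBall hθ) Metric.isClosed_closedBall)
    (interior_maximal (ball_subset_beattyArc hθ) Metric.isOpen_ball)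

lemma eventually_abs_card_filter_beattyArc_sub_le {θ c κ ε δ : ℝ} (hθ : 1 < θ)
    (hirr : Irrational θ) (hc : 0 < c) (hκ : 0 < κ) (hε : 0 < ε) (hδ : 0 < δ)
    (hft : ∀ m : ℕ, 0 < m → c / (m : ℝ) ^ κ ≤ |(m : ℝ) * θ - round ((m : ℝ) * θ)|) (ψ : ℝ) :
    ∀ᶠ N : ℕ in Filter.atTop, ∀ y : ℝ, Real.log N ^ (3 + ε) ≤ y →
      |(((smoothUpTo y N).filter
          fun m : ℕ => (((m : ℝ) / θ : ℝ) : UnitAddCircle) ∈ beattyArc θ ψ).card : ℝ) -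
        1 / θ * (smoothUpTo y N).card| ≤ δ * (smoothUpTo y N).card := by
  have hθ0 : 0 < θ := by linarith
  let S : ℕ × ℝ → Finset ℕ := fun p => smoothUpTo p.2 (max 1 p.1)
  let l : Filter (ℕ × ℝ) := Filter.comap Prod.fst Filter.atTop ⊓
    Filter.principal {p | Real.log p.1 ^ (3 + ε) ≤ p.2}
  have hS : ∀ p, (S p).Nonempty := fun p =>
    ⟨1, mem_smoothUpTo.2 ⟨le_rfl, le_max_left _ _, isSmooth_one _⟩⟩
  have hl : ∀ q : ℕ × ℝ → Prop, (∀ᶠ p in l, q p) ↔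
      ∀ᶠ N : ℕ in Filter.atTop, ∀ y, Real.log N ^ (3 + ε) ≤ y → q (N, y) := by
    intro q
    rw [Filter.eventually_inf_principal, Filter.eventually_comap]
    refine Filter.eventually_congr (Filter.Eventually.of_forall fun N => ?_)
    constructor
    · intro h y hy
      exact h (N, y) rfl hy
    · rintro h ⟨N', y⟩ rfl hy
      exact h y hy
  have hweyl := tendsto_card_filter_div_of_fourier (l := l) hS
    (g := fun m : ℕ => (((m : ℝ) / θ : ℝ) : UnitAddCircle)) (fun k hk => ?_)
    (volume_frontier_beattyArc (ψ := ψ) hθ0)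
  · rw [volume_beattyArc hθ, Metric.tendsto_nhds] at hweyl
    filter_upwards [(hl _).1 (hweyl δ hδ), Filter.eventually_ge_atTop 1] with N hN hN1 y hy
    have h := hN y hy
    have hc0 : (0 : ℝ) < (S (N, y)).card := by exact_mod_cast (hS _).card_pos
    rw [Real.dist_eq] at h
    have hSN : S (N, y) = smoothUpTo y N := by simp only [S, max_eq_right hN1]
    rw [← hSN]
    calc _ = |((((S (N, y)).filter fun m : ℕ => (((m : ℝ) / θ : ℝ) : UnitAddCircle) ∈ beattyArc θ ψ).card : ℝ) /
            (S (N, y)).card - 1 / θ) * (S (N, y)).card| := by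
          congr 1; field_simp
      _ = _ := by rw [abs_mul, abs_of_pos hc0]
      _ ≤ _ := by gcongr
  · obtain ⟨c', hc', hbd⟩ := exists_div_rpow_le_norm_intCast_div_mul hθ hc hκ hft hk
    have hirr' : Irrational (k / θ) := hirr.intCast_div hk
    rw [Metric.tendsto_nhds]
    intro η hη
    rw [hl]
    filter_upwards [eventually_norm_sum_e2pi_le hc' hκ hε (half_pos hη) hirr' hbd,
      Filter.eventually_ge_atTop 1] with N hN hN1 y hy
    have h := hN y hy
    have hc0 : (0 : ℝ) < (S (N, y)).card := by exact_mod_cast (hS _).card_pos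
    have hSN : S (N, y) = smoothUpTo y N := by simp only [S, max_eq_right hN1]
    rw [← hSN] at h
    rw [dist_zero_right, norm_mul, norm_inv, Complex.norm_natCast, inv_mul_lt_iff₀ hc0]
    simp_rw [fourier_coe_eq_e2pi]
    have hcongr : ∀ m : ℕ, (k : ℝ) * (m / θ) = k / θ * m := fun m => by ring
    simp_rw [hcongr]
    nlinarith

/-- Counting smooth terms of a Beatty sequence by their values, up to a bounded error. -/
lemma abs_card_beatty_sub_card_filter_le {θ ψ : ℝ} (hθ : 1 < θ) (hψ : 0 ≤ ψ) {x : ℝ} (hx : 0 ≤ x)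
    (y : ℝ) :
    |(Nat.card {n : ℕ | 1 ≤ n ∧ (n : ℝ) ≤ x ∧ IsSmooth y ⌊θ * n + ψ⌋₊} : ℝ) -
      ((smoothUpTo y ⌊θ * x⌋₊).filter
        fun m : ℕ => (((m : ℝ) / θ : ℝ) : UnitAddCircle) ∈ beattyArc θ ψ).card| ≤ ⌈ψ⌉₊ + 1 := by
  have hθ0 : 0 < θ := by linarith
  set N := ⌊θ * x⌋₊ with hN
  set f : ℕ → ℕ := fun n => ⌊θ * n + ψ⌋₊ with hf
  set G := (Finset.Icc 1 ⌊x⌋₊).filter fun n => IsSmooth y (f n) with hG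
  set B := (smoothUpTo y N).filter
    fun m : ℕ => (((m : ℝ) / θ : ℝ) : UnitAddCircle) ∈ beattyArc θ ψ with hB
  have hmemG : ∀ n : ℕ, n ∈ G ↔ 1 ≤ n ∧ (n : ℝ) ≤ x ∧ IsSmooth y (f n) := by
    intro n
    rw [hG, Finset.mem_filter, Finset.mem_Icc, Nat.le_floor_iff hx, and_assoc]
  have hcard : Nat.card {n : ℕ | 1 ≤ n ∧ (n : ℝ) ≤ x ∧ IsSmooth y ⌊θ * n + ψ⌋₊} = G.card := by
    have : {n : ℕ | 1 ≤ n ∧ (n : ℝ) ≤ x ∧ IsSmooth y ⌊θ * n + ψ⌋₊} = (G : Set ℕ) := by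
      ext n
      rw [Finset.mem_coe, hmemG]
      rfl
    rw [this]
    simp
  have hfbd : ∀ n : ℕ, (f n : ℝ) ≤ θ * n + ψ ∧ θ * n + ψ < f n + 1 := fun n =>
    ⟨Nat.floor_le (by positivity), Nat.lt_floor_add_one _⟩
  have hlt : θ * x < N + 1 := Nat.lt_floor_add_one _
  have hNle : (N : ℝ) ≤ θ * x := Nat.floor_le (by positivity)
  have hψle : ψ ≤ ⌈ψ⌉₊ := Nat.le_ceil _
  have hinj : Function.Injective f := by
    intro a b hab
    by_contra hne
    wlog hlt' : a < b generalizing a b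
    · exact this hab.symm (Ne.symm hne) (by omega)
    have h1 := (hfbd a).1
    have h2 := (hfbd b).2
    rw [hab] at h1
    have h3 : (a : ℝ) + 1 ≤ b := by exact_mod_cast hlt'
    nlinarith
  have hupper : G.card ≤ B.card + (⌈ψ⌉₊ + 1) := by
    have hsub : G.image f ⊆ B ∪ Finset.Ioc N (N + (⌈ψ⌉₊ + 1)) := by
      intro m hm
      obtain ⟨n, hn, rfl⟩ := Finset.mem_image.1 hm
      obtain ⟨hn1, hn2, hn3⟩ := (hmemG n).1 hn
      have hn1' : (1 : ℝ) ≤ n := by exact_mod_cast hn1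
      obtain ⟨h1, h2⟩ := hfbd n
      rcases le_or_gt (f n) N with hle | hgt
      · refine Finset.mem_union_left _ (Finset.mem_filter.2 ⟨mem_smoothUpTo.2 ⟨?_, hle, hn3⟩, ?_⟩)
        · exact (Nat.one_le_floor_iff _).2 (by nlinarith)
        · exact (coe_mem_beattyArc hθ0 _).2 ⟨n, by simpa using h1, by simpa using h2⟩
      · refine Finset.mem_union_right _ (Finset.mem_Ioc.2 ⟨hgt, ?_⟩)
        have : (f n : ℝ) < N + (⌈ψ⌉₊ + 1) := by nlinarith
        exact_mod_cast this.le
    calc G.card = (G.image f).card := (Finset.card_image_of_injective _ hinj).symm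
      _ ≤ _ := (Finset.card_le_card hsub).trans (Finset.card_union_le _ _)
      _ = _ := by rw [Nat.card_Ioc, Nat.add_sub_cancel_left]
  have hlower : B.card ≤ G.card + (⌈ψ⌉₊ + 1) := by
    have hsub : B ⊆ G.image f ∪ insert N (Finset.Icc 1 ⌈ψ⌉₊) := by
      intro m hm
      obtain ⟨hm1, hm2⟩ := Finset.mem_filter.1 hm
      obtain ⟨hm3, hm4, hm5⟩ := mem_smoothUpTo.1 hm1
      obtain ⟨n, h1, h2⟩ := (coe_mem_beattyArc hθ0 _).1 hm2
      rcases le_or_gt n 0 with hn0 | hn0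
      · refine Finset.mem_union_right _ (Finset.mem_insert_of_mem (Finset.mem_Icc.2 ⟨hm3, ?_⟩))
        have hn0' : (n : ℝ) ≤ 0 := by exact_mod_cast hn0
        have : (m : ℝ) ≤ ⌈ψ⌉₊ := by nlinarith
        exact_mod_cast this
      lift n to ℕ using hn0.le
      rw [Int.cast_natCast] at h1 h2
      have hfn : f n = m := (Nat.floor_eq_iff (by positivity)).2 ⟨h1, h2⟩
      rcases le_or_gt (n : ℝ) x with hnx | hnx
      · refine Finset.mem_union_left _ (Finset.mem_image.2 ⟨n, (hmemG n).2 ⟨?_, hnx, ?_⟩, hfn⟩)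
        · exact_mod_cast hn0
        · rwa [hfn]
      · refine Finset.mem_union_right _ (Finset.mem_insert.2 (Or.inl ?_))
        have : (N : ℝ) < m + 1 := by nlinarith
        have : N < m + 1 := by exact_mod_cast this
        omega
    calc B.card ≤ (G.image f).card + (insert N (Finset.Icc 1 ⌈ψ⌉₊)).card :=
          (Finset.card_le_card hsub).trans (Finset.card_union_le _ _)
      _ ≤ G.card + ((Finset.Icc 1 ⌈ψ⌉₊).card + 1) :=
          Nat.add_le_add Finset.card_image_le (Finset.card_insert_le _ _)
      _ = _ := by rw [Nat.card_Icc, Nat.add_sub_cancel]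
  rw [hcard, abs_le]
  have h1 : (G.card : ℝ) ≤ B.card + (⌈ψ⌉₊ + 1) := by exact_mod_cast hupper
  have h2 : (B.card : ℝ) ≤ G.card + (⌈ψ⌉₊ + 1) := by exact_mod_cast hlower
  constructor <;> linarith

lemma eventually_log_floor_mul_rpow_le {θ A ε : ℝ} (hθ : 1 < θ) (hA : 0 ≤ A) (hε : 0 < ε) :
    ∀ᶠ x : ℝ in Filter.atTop, Real.log ⌊θ * x⌋₊ ^ A ≤ Real.log x ^ (A + ε) := by
  have htend := (tendsto_rpow_atTop hε).comp Real.tendsto_log_atTop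
  filter_upwards [htend.eventually_ge_atTop ((2 : ℝ) ^ A), Filter.eventually_ge_atTop θ] with x h hx
  have hx0 : 0 < x := by linarith
  have hlogx : 0 < Real.log x := Real.log_pos (by linarith)
  have hle : Real.log ⌊θ * x⌋₊ ≤ 2 * Real.log x := by
    have h1 : (1 : ℝ) ≤ ⌊θ * x⌋₊ := by exact_mod_cast (Nat.one_le_floor_iff _).2 (by nlinarith)
    calc Real.log ⌊θ * x⌋₊ ≤ Real.log (θ * x) :=
          Real.log_le_log (by linarith) (Nat.floor_le (by positivity))
      _ = Real.log θ + Real.log x := Real.log_mul (by linarith) hx0.ne'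
      _ ≤ _ := by linarith [Real.log_le_log (by linarith) hx]
  calc Real.log ⌊θ * x⌋₊ ^ A ≤ (2 * Real.log x) ^ A :=
        Real.rpow_le_rpow (Real.log_natCast_nonneg _) hle hA
    _ = 2 ^ A * Real.log x ^ A := Real.mul_rpow (by norm_num) hlogx.le
    _ ≤ Real.log x ^ ε * Real.log x ^ A := by gcongr; exact h
    _ = _ := by rw [← Real.rpow_add hlogx, add_comm]

/-- Smooth numbers in Beatty sequences: for θ > 1 irrational of finite type and ψ ≥ 0,
uniformly for (log x)^(3+ε) ≤ y ≤ x, the number of n ≤ x with ⌊θn + ψ⌋ being y-smooth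
is (1/θ)·Ψ(θx, y)·(1 + o(1)). -/
theorem smooth_numbers_in_beatty_sequences
    (θ : ℝ) (hθ : 1 < θ) (hirr : Irrational θ)
    (c κ : ℝ) (hc : 0 < c) (hκ : 0 < κ)
    (hft : ∀ m : ℕ, 0 < m → c / (m : ℝ) ^ κ ≤ |(m : ℝ) * θ - round ((m : ℝ) * θ)|)
    (ψ : ℝ) (hψ : 0 ≤ ψ) (ε : ℝ) (hε : 0 < ε) (δ : ℝ) (hδ : 0 < δ) :
    ∃ x₀ : ℝ, ∀ x : ℝ, x₀ ≤ x → ∀ y : ℝ,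
      Real.log x ^ (3 + ε) ≤ y → y ≤ x →
      |(Nat.card {n : ℕ | 1 ≤ n ∧ (n : ℝ) ≤ x ∧ IsSmooth y ⌊θ * n + ψ⌋₊} : ℝ) -
          (1 / θ) * (Psi (θ * x) y : ℝ)| ≤ δ * (Psi (θ * x) y : ℝ) := by
  obtain ⟨M, hM⟩ := exists_nat_ge ((⌈ψ⌉₊ + 1) / (δ / 2))
  have hfloor : Filter.Tendsto (fun x : ℝ => ⌊θ * x⌋₊) Filter.atTop Filter.atTop :=
    tendsto_nat_floor_atTop.comp (Filter.tendsto_id.const_mul_atTop (by linarith))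
  have hlog := (tendsto_rpow_atTop (show (0 : ℝ) < 3 + ε by linarith)).comp Real.tendsto_log_atTop
  refine Filter.eventually_atTop.1 ?_
  filter_upwards [hfloor.eventually (eventually_abs_card_filter_beattyArc_sub_le hθ hirr hc hκ
      (half_pos hε) (half_pos hδ) hft ψ), hfloor.eventually_ge_atTop M,
    hlog.eventually_ge_atTop (M : ℝ), eventually_log_floor_mul_rpow_le hθ
      (show 0 ≤ 3 + ε / 2 by linarith) (half_pos hε), Filter.eventually_ge_atTop 0] with
    x hequi hMN hMy hlogN hx0 y hy _
  rw [Psi_eq_card]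
  set N := ⌊θ * x⌋₊ with hN
  have hexp : 3 + ε / 2 + ε / 2 = 3 + ε := by ring
  rw [hexp] at hlogN
  have h1 := hequi y (hlogN.trans hy)
  have h2 := abs_card_beatty_sub_card_filter_le hθ hψ hx0 y
  have h3 : (M : ℝ) ≤ (smoothUpTo y N).card := by
    have h := card_smoothUpTo_of_le (le_trans hMy hy)
    have := Finset.card_le_card (smoothUpTo_mono (y := y) hMN)
    rw [h] at this
    exact_mod_cast this
  have h4 : (⌈ψ⌉₊ + 1 : ℝ) ≤ δ / 2 * (smoothUpTo y N).card := by
    rw [div_le_iff₀ (half_pos hδ)] at hM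
    nlinarith
  calc _ ≤ _ := abs_sub_le _ _ _
    _ ≤ (⌈ψ⌉₊ + 1 : ℝ) + δ / 2 * (smoothUpTo y N).card := add_le_add h2 h1
    _ ≤ _ := by linarith
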